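/- arXiv:2008.02351 — 4 statements merged into one kernel-verified Lean document; each statement's English description precedes it below -/
import Mathlib

section
/- Let A ⊆ ℕ be an infinite set and for each N let A_N denote the set of its N smallest elements. Suppose ψ : ℕ → [0,1] is a weakly decreasing function such that the series Σ_N ψ(N)/N converges, and that E(A_N) ≪ N³ψ(N) (i.e., there is a constant c > 0 with E(A_N) ≤ c·N³ψ(N) for all N). Then A has doubly metric Poissonian pair correlations: for Lebesgue-almost every pair (α, γ) ∈ T² and every real s > 0, F(α, γ, s, N, A) → 2s as N → ∞. -/
open MeasureTheory Filter Set

noncomputable section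

/-- The torus `𝕋 = ℝ/ℤ`, equipped with its Haar (Lebesgue) probability measure `volume`. -/
abbrev 𝕋 := UnitAddCircle

/-- The increasing enumeration (0-indexed) of a set `A ⊆ ℕ`; for infinite `A`,
`enum A 0 < enum A 1 < ⋯` lists the elements of `A` in increasing order. -/
noncomputable def enum (A : Set ℕ) (n : ℕ) : ℕ := Nat.nth (· ∈ A) n

/-- `A_N`: the set of the `N` smallest elements of `A` (for `A` infinite). -/
noncomputable def firstN (A : Set ℕ) (N : ℕ) : Finset ℕ :=
  (Finset.range N).image (enum A)

/-- Additive energy `E(A) = #{(a,b,c,d) ∈ A⁴ : a + b = c + d}` of a finite set `A ⊆ ℕ`. -/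
def addE (A : Finset ℕ) : ℕ :=
  (((A ×ˢ A) ×ˢ (A ×ˢ A)).filter (fun q => q.1.1 + q.1.2 = q.2.1 + q.2.2)).card

/-- The inhomogeneous pair correlation function
`F(γ, s, N, x) = (1/N) · #{(i,j) ∈ [N]×[N] : i ≠ j, ‖x_i − x_j − γ‖ ≤ s/N}`
of a sequence `x` of points of `𝕋` (indices `0, …, N-1` playing the role of `[N]`). -/
noncomputable def Fseq (γ : 𝕋) (s : ℝ) (N : ℕ) (x : ℕ → 𝕋) : ℝ :=
  (Set.ncard {ij : ℕ × ℕ | ij.1 < N ∧ ij.2 < N ∧ ij.1 ≠ ij.2 ∧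
      ‖x ij.1 - x ij.2 - γ‖ ≤ s / N} : ℝ) / N

/-- `F(α, γ, s, N, 𝒜)`: the pair correlation function of the points `a_n α ∈ 𝕋`,
where `(a_n)` is the increasing enumeration of `A ⊆ ℕ`. -/
noncomputable def Fpc (α γ : 𝕋) (s : ℝ) (N : ℕ) (A : Set ℕ) : ℝ :=
  Fseq γ s N (fun n => (enum A n) • α)

/-- `A ⊆ ℕ` has doubly metric Poissonian pair correlations along the sequence `Nt`:
for Lebesgue-a.e. `(α, γ) ∈ 𝕋²` and every `s > 0`, `F(α, γ, s, N_t, 𝒜) → 2s`. -/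
def DMPPCAlong (A : Set ℕ) (Nt : ℕ → ℕ) : Prop :=
  ∀ᵐ p : 𝕋 × 𝕋, ∀ s : ℝ, 0 < s →
    Tendsto (fun t => Fpc p.1 p.2 s (Nt t) A) atTop (nhds (2 * s))

/-- `A ⊆ ℕ` has doubly metric Poissonian pair correlations. -/
def DMPPC (A : Set ℕ) : Prop := DMPPCAlong A id

instance : IsProbabilityMeasure (volume : Measure 𝕋) := ⟨UnitAddCircle.measure_univ⟩

/-- The event that the shift `γ` lies within `r` of `d • α`. -/
def nearShift (d : ℤ) (r : ℝ) : Set (𝕋 × 𝕋) := {p | ‖d • p.1 - p.2‖ ≤ r}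

/-- The measure of a closed ball of radius `r` in the torus. -/
def ballMeasure (r : ℝ) : ℝ := volume.real (Metric.closedBall (0 : 𝕋) r)

lemma ballMeasure_nonneg (r : ℝ) : 0 ≤ ballMeasure r := measureReal_nonneg

lemma ballMeasure_eq {r : ℝ} (hr : 0 ≤ r) : ballMeasure r = min 1 (2 * r) := by
  rw [ballMeasure, measureReal_def, AddCircle.volume_closedBall,
    ENNReal.toReal_ofReal (le_min zero_le_one (by positivity))]

lemma measurableSet_nearShift (d : ℤ) (r : ℝ) : MeasurableSet (nearShift d r) := by
  refine (isClosed_le ?_ continuous_const).measurableSet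
  fun_prop

lemma volume_real_nearShift_inter {d e : ℤ} (h : d ≠ e) (r : ℝ) :
    volume.real (nearShift d r ∩ nearShift e r) = ballMeasure r ^ 2 := by
  let shift (k : ℤ) : 𝕋 × 𝕋 →+ 𝕋 := k • AddMonoidHom.fst 𝕋 𝕋 - AddMonoidHom.snd 𝕋 𝕋
  let f : 𝕋 × 𝕋 →+ 𝕋 × 𝕋 := (shift d).prod (shift e)
  have hf : ∀ p, f p = (d • p.1 - p.2, e • p.1 - p.2) := fun p => rfl
  have hcont : Continuous f := by
    change Continuous fun p => f p
    simp only [hf]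
    fun_prop
  have hsurj : Function.Surjective f := by
    rintro ⟨x, y⟩
    have hde : d - e ≠ 0 := sub_ne_zero.mpr h
    refine ⟨(DivisibleBy.div (x - y) (d - e), d • DivisibleBy.div (x - y) (d - e) - x), ?_⟩
    have hdiv : (d - e) • (DivisibleBy.div (x - y) (d - e) : 𝕋) = x - y :=
      DivisibleBy.div_cancel _ hde
    rw [sub_smul] at hdiv
    rw [hf, Prod.mk.injEq]
    refine ⟨by simp, ?_⟩
    simp only
    rw [← sub_add, ← neg_sub, hdiv]
    abel
  have hmp : MeasurePreserving f (volume.prod volume) (volume.prod volume) :=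
    AddMonoidHom.measurePreserving hcont hsurj rfl
  have hpre : nearShift d r ∩ nearShift e r =
      f ⁻¹' (Metric.closedBall 0 r ×ˢ Metric.closedBall 0 r) := by
    ext p
    simp [nearShift, hf]
  rw [hpre, Measure.volume_eq_prod, measureReal_def, hmp.measure_preimage
    (measurableSet_closedBall.prod measurableSet_closedBall).nullMeasurableSet,
    Measure.prod_prod, ENNReal.toReal_mul, sq]
  rfl

lemma volume_real_nearShift (d : ℤ) (r : ℝ) : volume.real (nearShift d r) = ballMeasure r := by
  let f : 𝕋 × 𝕋 →+ 𝕋 := d • AddMonoidHom.fst 𝕋 𝕋 - AddMonoidHom.snd 𝕋 𝕋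
  have hf : ∀ p, f p = d • p.1 - p.2 := fun p => rfl
  have hcont : Continuous f := by
    change Continuous fun p => f p
    simp only [hf]
    fun_prop
  have hsurj : Function.Surjective f := fun x => ⟨(0, -x), by simp [hf]⟩
  have hmp : MeasurePreserving f (volume.prod volume) volume :=
    AddMonoidHom.measurePreserving hcont hsurj (by simp)
  have hpre : nearShift d r = f ⁻¹' Metric.closedBall 0 r := by
    ext p
    simp [nearShift, hf]
  rw [hpre, Measure.volume_eq_prod, measureReal_def,
    hmp.measure_preimage measurableSet_closedBall.nullMeasurableSet]
  rfl

/-- The indicator function of `nearShift d r`. -/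
def nearShiftIndicator (d : ℤ) (r : ℝ) : 𝕋 × 𝕋 → ℝ := (nearShift d r).indicator 1

lemma memLp_nearShiftIndicator (d : ℤ) (r : ℝ) : MemLp (nearShiftIndicator d r) 2 :=
  memLp_indicator_const 2 (measurableSet_nearShift d r) (1 : ℝ) (Or.inr (measure_ne_top _ _))

lemma integral_nearShiftIndicator (d : ℤ) (r : ℝ) :
    ∫ p, nearShiftIndicator d r p = ballMeasure r := by
  rw [nearShiftIndicator, integral_indicator_one (measurableSet_nearShift d r),
    volume_real_nearShift]

lemma covariance_nearShiftIndicator_le (d e : ℤ) (r : ℝ) :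
    ProbabilityTheory.covariance (nearShiftIndicator d r) (nearShiftIndicator e r) volume ≤
      if d = e then ballMeasure r else 0 := by
  have hmul : nearShiftIndicator d r * nearShiftIndicator e r =
      (nearShift d r ∩ nearShift e r).indicator 1 := by
    rw [nearShiftIndicator, nearShiftIndicator, Set.inter_indicator_one]
  rw [ProbabilityTheory.covariance_eq_sub (memLp_nearShiftIndicator d r)
    (memLp_nearShiftIndicator e r), hmul,
    integral_indicator_one ((measurableSet_nearShift d r).inter (measurableSet_nearShift e r)),
    integral_nearShiftIndicator, integral_nearShiftIndicator]
  split_ifs with h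
  · subst h
    rw [Set.inter_self, volume_real_nearShift]
    nlinarith [sq_nonneg (ballMeasure r)]
  · rw [volume_real_nearShift_inter h]
    exact le_of_eq (by ring)

/-- The difference of the elements of `A` indexed by a pair. -/
def enumDiff (A : Set ℕ) (p : ℕ × ℕ) : ℤ := (enum A p.1 : ℤ) - enum A p.2

lemma enum_injective {A : Set ℕ} (hA : A.Infinite) : Function.Injective (enum A) :=
  Nat.nth_injective hA

lemma card_enumDiff_eq_le_addE {A : Set ℕ} (hA : A.Infinite) (N : ℕ) :
    (((Finset.range N).offDiag ×ˢ (Finset.range N).offDiag).filter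
      (fun q => enumDiff A q.1 = enumDiff A q.2)).card ≤ addE (firstN A N) := by
  refine Finset.card_le_card_of_injOn
    (fun q => ((enum A q.1.1, enum A q.2.2), (enum A q.2.1, enum A q.1.2))) ?_ ?_
  · rintro ⟨⟨i, j⟩, k, l⟩ h
    simp only [Finset.mem_coe, Finset.mem_filter, Finset.mem_product, Finset.mem_offDiag,
      Finset.mem_range] at h
    simp only [enumDiff] at h
    simp only [firstN, Finset.mem_coe, Finset.mem_filter, Finset.mem_product]
    refine ⟨⟨⟨?_, ?_⟩, ?_, ?_⟩, by lia⟩ <;>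
    exact Finset.mem_image_of_mem _ (Finset.mem_range.mpr (by tauto))
  · rintro ⟨⟨i, j⟩, k, l⟩ - ⟨⟨i', j'⟩, k', l'⟩ - h
    simp only [Prod.mk.injEq, (enum_injective hA).eq_iff] at h
    simp only [Prod.mk.injEq]
    tauto

lemma Fpc_eq_sum (α γ : 𝕋) (s : ℝ) (N : ℕ) (A : Set ℕ) :
    Fpc α γ s N A = (N : ℝ)⁻¹ *
      ∑ p ∈ (Finset.range N).offDiag, nearShiftIndicator (enumDiff A p) (s / N) (α, γ) := by
  classical
  have hset : {ij : ℕ × ℕ | ij.1 < N ∧ ij.2 < N ∧ ij.1 ≠ ij.2 ∧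
      ‖enum A ij.1 • α - enum A ij.2 • α - γ‖ ≤ s / N} =
      (((Finset.range N).offDiag.filter
        (fun p => (α, γ) ∈ nearShift (enumDiff A p) (s / N)) : Finset (ℕ × ℕ)) :
          Set (ℕ × ℕ)) := by
    ext p
    simp [nearShift, enumDiff, sub_smul, and_assoc]
  rw [Fpc, Fseq, hset, Set.ncard_coe_finset, div_eq_inv_mul, Finset.card_filter]
  push_cast
  simp [nearShiftIndicator, Set.indicator_apply]

lemma memLp_Fpc (A : Set ℕ) (s : ℝ) (N : ℕ) :
    MemLp (fun p : 𝕋 × 𝕋 => Fpc p.1 p.2 s N A) 2 := by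
  simp only [Fpc_eq_sum]
  exact (memLp_finsetSum _ fun p _ => memLp_nearShiftIndicator _ _).const_mul _

lemma integral_Fpc (A : Set ℕ) (s : ℝ) (N : ℕ) :
    ∫ p : 𝕋 × 𝕋, Fpc p.1 p.2 s N A = (N : ℝ)⁻¹ * ((N * N - N) * ballMeasure (s / N)) := by
  simp only [Fpc_eq_sum]
  rw [integral_const_mul, integral_finsetSum _
    fun p _ => (memLp_nearShiftIndicator _ _).integrable (by norm_num)]
  simp only [integral_nearShiftIndicator, Finset.sum_const, Finset.offDiag_card,
    Finset.card_range, nsmul_eq_mul]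
  rw [Nat.cast_sub (Nat.le_mul_self N), Nat.cast_mul]

lemma variance_Fpc_le {A : Set ℕ} (hA : A.Infinite) (s : ℝ) (N : ℕ) :
    ProbabilityTheory.variance (fun p : 𝕋 × 𝕋 => Fpc p.1 p.2 s N A) volume ≤
      ((N : ℝ)⁻¹) ^ 2 * (addE (firstN A N) * ballMeasure (s / N)) := by
  simp only [Fpc_eq_sum]
  rw [ProbabilityTheory.variance_const_mul]
  refine mul_le_mul_of_nonneg_left ?_ (sq_nonneg _)
  simp only [Prod.mk.eta]
  rw [ProbabilityTheory.variance_fun_sum' fun p _ => memLp_nearShiftIndicator _ _]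
  calc
    _ ≤ ∑ p ∈ (Finset.range N).offDiag, ∑ q ∈ (Finset.range N).offDiag,
        if enumDiff A p = enumDiff A q then ballMeasure (s / N) else 0 :=
      Finset.sum_le_sum fun p _ => Finset.sum_le_sum fun q _ =>
        covariance_nearShiftIndicator_le _ _ _
    _ = (((Finset.range N).offDiag ×ˢ (Finset.range N).offDiag).filter
          (fun q => enumDiff A q.1 = enumDiff A q.2)).card * ballMeasure (s / N) := by
      rw [← Finset.sum_product', ← Finset.sum_filter, Finset.sum_const, nsmul_eq_mul]
    _ ≤ _ := mul_le_mul_of_nonneg_right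
      (Nat.cast_le.mpr (card_enumDiff_eq_le_addE hA N)) (ballMeasure_nonneg _)

/-- If the variances of a sequence of random variables are summable and the means converge,
then the sequence converges almost surely. -/
lemma ae_tendsto_of_summable_variance {Ω : Type*} [MeasurableSpace Ω] {μ : Measure Ω}
    [IsProbabilityMeasure μ] {X : ℕ → Ω → ℝ} (hX : ∀ n, MemLp (X n) 2 μ) {v : ℕ → ℝ}
    (hv : Summable v) (hXv : ∀ n, ProbabilityTheory.variance (X n) μ ≤ v n) {l : ℝ}
    (hl : Tendsto (fun n => ∫ ω, X n ω ∂μ) atTop (nhds l)) :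
    ∀ᵐ ω ∂μ, Tendsto (fun n => X n ω) atTop (nhds l) := by
  have hmeas : ∀ n, AEMeasurable (fun ω => ‖X n ω - ∫ ω, X n ω ∂μ‖ₑ ^ 2) μ := fun n =>
    (((hX n).aestronglyMeasurable.aemeasurable.sub_const _).enorm).pow_const 2
  have hfin : ∫⁻ ω, ∑' n, ‖X n ω - ∫ ω, X n ω ∂μ‖ₑ ^ 2 ∂μ ≠ ⊤ := by
    rw [lintegral_tsum hmeas]
    refine ne_top_of_le_ne_top hv.tsum_ofReal_ne_top (ENNReal.tsum_le_tsum fun n => ?_)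
    change ProbabilityTheory.evariance (X n) μ ≤ _
    rw [← ProbabilityTheory.ofReal_variance (hX n)]
    exact ENNReal.ofReal_le_ofReal (hXv n)
  filter_upwards [ae_lt_top' (AEMeasurable.tsum hmeas) hfin] with ω hω
  have h2 := ENNReal.tendsto_atTop_zero_of_tsum_ne_top hω.ne
  have h0 : Tendsto (fun n => X n ω - ∫ ω, X n ω ∂μ) atTop (nhds 0) := by
    have h3 := (ENNReal.tendsto_toReal ENNReal.zero_ne_top).comp h2
    have h4 := h3.sqrt
    simp only [Function.comp_def, ENNReal.toReal_pow, toReal_enorm, ENNReal.toReal_zero,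
      Real.sqrt_zero, Real.sqrt_sq (norm_nonneg _)] at h4
    exact tendsto_zero_iff_norm_tendsto_zero.mpr h4
  simpa using h0.add hl

lemma tendsto_integral_Fpc (A : Set ℕ) {s : ℝ} (hs : 0 < s) :
    Tendsto (fun N : ℕ => ∫ p : 𝕋 × 𝕋, Fpc p.1 p.2 s N A) atTop (nhds (2 * s)) := by
  have hlim : Tendsto (fun N : ℕ => 2 * s - 2 * s * (N : ℝ)⁻¹) atTop (nhds (2 * s)) := by
    simpa using (tendsto_inv_atTop_nhds_zero_nat (𝕜 := ℝ)).const_mul (2 * s) |>.const_sub (2 * s)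
  refine hlim.congr' ?_
  filter_upwards [eventually_gt_atTop 0, eventually_ge_atTop ⌈2 * s⌉₊] with N hN hNs
  have hN' : (0 : ℝ) < N := Nat.cast_pos.mpr hN
  have hle : 2 * (s / N) ≤ 1 := by
    rw [← mul_div_assoc, div_le_one hN']
    exact Nat.ceil_le.mp hNs
  rw [integral_Fpc, ballMeasure_eq (by positivity), min_eq_right hle]
  field_simp

/-- Along each sequence `m * 2 ^ t`, the pair correlation function converges almost surely. -/
lemma ae_tendsto_Fpc_mul_two_pow {A : Set ℕ} (hA : A.Infinite) {ψ : ℕ → ℝ}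
    (hψ0 : ∀ N, 0 ≤ ψ N) (hψmono : Antitone ψ) (hsum : Summable (fun N : ℕ => ψ N / N))
    {c : ℝ} (hc : 0 < c) (hE : ∀ N : ℕ, (addE (firstN A N) : ℝ) ≤ c * (N : ℝ) ^ 3 * ψ N)
    {m : ℕ} (hm : 0 < m) {s : ℝ} (hs : 0 < s) :
    ∀ᵐ p : 𝕋 × 𝕋, Tendsto (fun t => Fpc p.1 p.2 s (m * 2 ^ t) A) atTop (nhds (2 * s)) := by
  have hsum2 : Summable fun t : ℕ => ψ (2 ^ t) := by
    have := (summable_condensed_iff_of_nonneg (f := fun N : ℕ => ψ N / N)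
      (fun n => div_nonneg (hψ0 n) n.cast_nonneg) (fun a b ha hab =>
        div_le_div₀ (hψ0 a) (hψmono hab) (Nat.cast_pos.mpr ha) (Nat.cast_le.mpr hab))).mpr hsum
    refine this.congr fun t => ?_
    push_cast
    field_simp
  have hN : ∀ t, 0 < m * 2 ^ t := fun t => by positivity
  have htop : Tendsto (fun t : ℕ => m * 2 ^ t) atTop atTop :=
    (tendsto_pow_atTop_atTop_of_one_lt one_lt_two).const_mul_atTop' hm
  refine ae_tendsto_of_summable_variance (fun t => memLp_Fpc A s (m * 2 ^ t))
    (hsum2.mul_left (2 * s * c)) (fun t => ?_) ((tendsto_integral_Fpc A hs).comp htop)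
  refine (variance_Fpc_le hA s (m * 2 ^ t)).trans ?_
  have hle : 2 ^ t ≤ m * 2 ^ t := Nat.le_mul_of_pos_left _ hm
  have hpos := hN t
  generalize m * 2 ^ t = N at hle hpos ⊢
  have hN' : (0 : ℝ) < N := Nat.cast_pos.mpr hpos
  have hb : ballMeasure (s / N) ≤ 2 * (s / N) := by
    rw [ballMeasure_eq (by positivity)]
    exact min_le_right _ _
  calc
    _ ≤ ((N : ℝ)⁻¹) ^ 2 * (c * (N : ℝ) ^ 3 * ψ N * (2 * (s / N))) := by
      gcongr
      · exact ballMeasure_nonneg _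
      · exact mul_nonneg (by positivity) (hψ0 N)
      · exact hE N
    _ = 2 * s * c * ψ N := by field_simp
    _ ≤ _ := mul_le_mul_of_nonneg_left (hψmono hle) (by positivity)

/-- For `N` at least `M`, the integer `N` lies between consecutive multiples of a power of two,
with a multiplier in `[M, 2M)`. -/
lemma exists_mul_two_pow_le_lt {M N : ℕ} (hM : 0 < M) (hN : M ≤ N) :
    ∃ t m, M ≤ m ∧ m < 2 * M ∧ m * 2 ^ t ≤ N ∧ N < (m + 1) * 2 ^ t := by
  have hNM : N / M ≠ 0 := (Nat.div_pos hN hM).ne'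
  refine ⟨Nat.log 2 (N / M), N / 2 ^ Nat.log 2 (N / M), ?_, ?_, Nat.div_mul_le_self _ _, ?_⟩
  · have h := Nat.pow_log_le_self 2 hNM
    rw [Nat.le_div_iff_mul_le (by positivity)] at h ⊢
    rwa [mul_comm]
  · have h := Nat.lt_pow_succ_log_self one_lt_two (N / M)
    rw [Nat.div_lt_iff_lt_mul hM, pow_succ] at h
    rw [Nat.div_lt_iff_lt_mul (by positivity)]
    linarith
  · exact Nat.lt_mul_of_div_lt (Nat.lt_succ_self _) (by positivity)

lemma eventually_exists_mul_two_pow {P : ℕ → ℕ → Prop} {M : ℕ} (hM : 0 < M)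
    (hP : ∀ m, 0 < m → ∀ᶠ t in atTop, P m t) :
    ∀ᶠ N : ℕ in atTop, ∃ t m, M ≤ m ∧ m * 2 ^ t ≤ N ∧ N < (m + 1) * 2 ^ t ∧
      P m t ∧ P (m + 1) t := by
  have hall : ∀ᶠ t in atTop, ∀ m ∈ Finset.Icc 1 (2 * M), P m t :=
    (Filter.eventually_all_finset _).mpr fun m hm => hP m (Finset.mem_Icc.mp hm).1
  obtain ⟨T, hT⟩ := eventually_atTop.mp hall
  filter_upwards [eventually_ge_atTop M, eventually_ge_atTop (2 * M * 2 ^ T)] with N hN hNT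
  obtain ⟨t, m, hMm, hm, hle, hlt⟩ := exists_mul_two_pow_le_lt hM hN
  have hTt : T ≤ t := by
    have h1 : 2 * M * 2 ^ T < 2 * M * 2 ^ t :=
      (hNT.trans_lt hlt).trans_le (Nat.mul_le_mul_right _ hm)
    exact ((Nat.pow_lt_pow_iff_right one_lt_two).mp (Nat.lt_of_mul_lt_mul_left h1)).le
  exact ⟨t, m, hMm, hle, hlt, hT t hTt m (Finset.mem_Icc.mpr (by lia)),
    hT t hTt (m + 1) (Finset.mem_Icc.mpr (by lia))⟩

lemma succ_mul_two_pow_le {M m t : ℕ} (hM : 0 < M) (hMm : M ≤ m) :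
    (((m + 1) * 2 ^ t : ℕ) : ℝ) ≤ (1 + 1 / (M : ℝ)) * (m * 2 ^ t : ℕ) := by
  have hM' : (0 : ℝ) < M := Nat.cast_pos.mpr hM
  have h1 : (1 : ℝ) ≤ m / M := (one_le_div hM').mpr (Nat.cast_le.mpr hMm)
  push_cast
  rw [← mul_assoc]
  refine mul_le_mul_of_nonneg_right ?_ (by positivity)
  rw [add_mul, one_mul, one_div_mul_eq_div]
  linarith

/-- Convergence of normalized counts along all sequences `m * 2 ^ t` and all positive rational
scales implies convergence along all integers and all positive real scales. -/
lemma tendsto_of_tendsto_mul_two_pow {C : ℕ → ℝ → ℝ} (hC : ∀ N r, 0 ≤ C N r)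
    (hmono : ∀ ⦃N N' r r'⦄, N ≤ N' → r ≤ r' → C N r ≤ C N' r')
    (h : ∀ m : ℕ, 0 < m → ∀ q : ℚ, 0 < q →
      Tendsto (fun t : ℕ => C (m * 2 ^ t) (q / (m * 2 ^ t : ℕ)) / (m * 2 ^ t : ℕ)) atTop
        (nhds (2 * q)))
    {s : ℝ} (hs : 0 < s) : Tendsto (fun N : ℕ => C N (s / N) / N) atTop (nhds (2 * s)) := by
  have hlim (x : ℝ) : Tendsto (fun M : ℕ => x * (1 + 1 / (M : ℝ))) atTop (nhds x) := by
    simpa using (tendsto_one_div_atTop_nhds_zero_nat (𝕜 := ℝ)).const_add 1 |>.const_mul x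
  refine tendsto_order.mpr ⟨fun a ha => ?_, fun b hb => ?_⟩
  · rcases lt_or_ge a 0 with ha0 | ha0
    · exact Eventually.of_forall fun N => ha0.trans_le (div_nonneg (hC _ _) N.cast_nonneg)
    obtain ⟨q, haq, hqs⟩ := exists_rat_btwn (show a / 2 < s by linarith)
    have hq0 : (0 : ℝ) < q := by linarith
    obtain ⟨M, hM, hMq, hMa⟩ := ((eventually_gt_atTop 0).and
      (((hlim q).eventually_lt_const hqs).and
        ((hlim a).eventually_lt_const (show a < 2 * q by linarith)))).exists
    filter_upwards [eventually_exists_mul_two_pow hM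
      fun m hm => (h m hm q (by exact_mod_cast hq0)).eventually_const_lt hMa]
      with N ⟨t, m, hMm, hle, hlt, hP, _⟩
    have hρ := succ_mul_two_pow_le (t := t) hM hMm
    have hK : 0 < m * 2 ^ t := Nat.mul_pos (hM.trans_le hMm) (by positivity)
    generalize m * 2 ^ t = K at *
    generalize (m + 1) * 2 ^ t = L at *
    have hK' : (0 : ℝ) < K := Nat.cast_pos.mpr hK
    have hN' : (0 : ℝ) < N := Nat.cast_pos.mpr (hK.trans_le hle)
    have hNρ : (N : ℝ) ≤ (1 + 1 / (M : ℝ)) * K := (Nat.cast_le.mpr hlt.le).trans hρ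
    generalize 1 + 1 / (M : ℝ) = ρ at *
    rw [lt_div_iff₀ hK'] at hP
    rw [lt_div_iff₀ hN']
    have hscale : (q : ℝ) / K ≤ s / N := by
      rw [div_le_div_iff₀ hK' hN']
      nlinarith
    nlinarith [hmono hle hscale]
  · obtain ⟨q, hsq, hqb⟩ := exists_rat_btwn (show s < b / 2 by linarith)
    have hq0 : (0 : ℝ) < q := hs.trans hsq
    obtain ⟨M, hM, hMs, hMb⟩ := ((eventually_gt_atTop 0).and
      (((hlim s).eventually_lt_const hsq).and
        ((hlim (2 * q)).eventually_lt_const (show 2 * (q : ℝ) < b by linarith)))).exists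
    have hρ0 : (0 : ℝ) < 1 + 1 / M := by positivity
    filter_upwards [eventually_exists_mul_two_pow hM
      fun m hm => (h m hm q (by exact_mod_cast hq0)).eventually_lt_const
        ((lt_div_iff₀ hρ0).mpr hMb)]
      with N ⟨t, m, hMm, hle, hlt, _, hP⟩
    have hρ := succ_mul_two_pow_le (t := t) hM hMm
    have hK : 0 < m * 2 ^ t := Nat.mul_pos (hM.trans_le hMm) (by positivity)
    generalize m * 2 ^ t = K at *
    generalize (m + 1) * 2 ^ t = L at *
    have hN' : (0 : ℝ) < N := Nat.cast_pos.mpr (hK.trans_le hle)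
    have hL' : (0 : ℝ) < L := hN'.trans (Nat.cast_lt.mpr hlt)
    have hLρ : (L : ℝ) ≤ (1 + 1 / (M : ℝ)) * N :=
      hρ.trans (mul_le_mul_of_nonneg_left (Nat.cast_le.mpr hle) hρ0.le)
    generalize 1 + 1 / (M : ℝ) = ρ at *
    rw [div_lt_div_iff₀ hL' hρ0] at hP
    rw [div_lt_iff₀ hN']
    have hscale : s / N ≤ q / L := by
      rw [div_le_div_iff₀ hN' hL']
      nlinarith
    have hb0 : 0 < b := by linarith
    have hCC := hmono hlt.le hscale
    have hbL : b * L ≤ b * N * ρ := by nlinarith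
    exact hCC.trans_lt (lt_of_mul_lt_mul_right (hP.trans_le hbL) hρ0.le)

/-- The number of pairs of distinct indices below `N` for which `x i - x j` is within `r` of `γ`. -/
def pairCount (γ : 𝕋) (x : ℕ → 𝕋) (N : ℕ) (r : ℝ) : ℝ :=
  Set.ncard {ij : ℕ × ℕ | ij.1 < N ∧ ij.2 < N ∧ ij.1 ≠ ij.2 ∧ ‖x ij.1 - x ij.2 - γ‖ ≤ r}

lemma pairCount_mono (γ : 𝕋) (x : ℕ → 𝕋) ⦃N N' : ℕ⦄ ⦃r r' : ℝ⦄ (hN : N ≤ N') (hr : r ≤ r') :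
    pairCount γ x N r ≤ pairCount γ x N' r' := by
  refine Nat.cast_le.mpr (Set.ncard_le_ncard ?_ ?_)
  · rintro p ⟨h1, h2, h3, h4⟩
    exact ⟨h1.trans_le hN, h2.trans_le hN, h3, h4.trans hr⟩
  · refine ((Set.finite_Iio N').prod (Set.finite_Iio N')).subset ?_
    rintro p ⟨h1, h2, -⟩
    exact ⟨h1, h2⟩

/-- **Theorem (sufficiency, doubly metric).** If `A ⊆ ℕ` is infinite, `ψ : ℕ → [0,1]` is weakly
decreasing, `∑ ψ(N)/N` converges, and `E(A_N) ≤ c·N³·ψ(N)` for all `N` (some `c > 0`),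
then `A` has doubly metric Poissonian pair correlations. -/
theorem stmt_0 (A : Set ℕ) (hA : A.Infinite) (ψ : ℕ → ℝ)
    (hψ01 : ∀ N, ψ N ∈ Set.Icc (0 : ℝ) 1) (hψmono : Antitone ψ)
    (hsum : Summable (fun N : ℕ => ψ N / N))
    (c : ℝ) (hc : 0 < c)
    (hE : ∀ N : ℕ, (addE (firstN A N) : ℝ) ≤ c * (N : ℝ) ^ 3 * ψ N) :
    DMPPC A := by
  have hae : ∀ᵐ p : 𝕋 × 𝕋, ∀ m : ℕ, 0 < m → ∀ q : ℚ, 0 < q →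
      Tendsto (fun t => Fpc p.1 p.2 q (m * 2 ^ t) A) atTop (nhds (2 * q)) := by
    simp only [ae_all_iff]
    exact fun m hm q hq => ae_tendsto_Fpc_mul_two_pow hA (fun N => (hψ01 N).1) hψmono hsum hc hE hm
      (Rat.cast_pos.mpr hq)
  filter_upwards [hae] with p hp s hs
  exact tendsto_of_tendsto_mul_two_pow (C := pairCount p.2 fun n => enum A n • p.1)
    (fun N r => Nat.cast_nonneg _) (pairCount_mono _ _) hp hs
end
end

section
/- Let P = (p_n) be the increasing sequence of all prime numbers. Every strictly increasing sequence of natural numbers (N_t) has a subsequence (M_t) along which P has doubly metric Poissonian pair correlations: for Lebesgue-almost every (α, γ) ∈ T² and every s > 0, F(α, γ, s, M_t, P) → 2s as t → ∞. -/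
open MeasureTheory Filter Set

noncomputable section

theorem abs_count_modEq_sub_div_le_one {r : ℕ} (hr : 0 < r) (x v : ℕ) :
    |(((Finset.range x).filter (fun n => n ≡ v [MOD r])).card : ℝ) - x / r| ≤ 1 := by
  have h := Nat.count_modEq_card x hr v
  rw [Nat.count_eq_card_filter_range] at h
  rw [h]
  have hr' : (0 : ℝ) < r := by exact_mod_cast hr
  have e : (x : ℝ) = r * ((x / r : ℕ) : ℝ) + ((x % r : ℕ) : ℝ) := by
    exact_mod_cast (Nat.div_add_mod x r).symm
  have hm : ((x % r : ℕ) : ℝ) < r := by exact_mod_cast Nat.mod_lt x hr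
  have hm0 : (0 : ℝ) ≤ ((x % r : ℕ) : ℝ) := by positivity
  have e2 : (x : ℝ) / r = ((x / r : ℕ) : ℝ) + ((x % r : ℕ) : ℝ) / r := by
    rw [eq_comm, ← sub_eq_zero]; field_simp; linarith
  have h1 : ((x % r : ℕ) : ℝ) / r < 1 := (div_lt_one hr').2 hm
  have h0 : 0 ≤ ((x % r : ℕ) : ℝ) / r := by positivity
  rw [e2, abs_le]
  push_cast
  split_ifs <;> constructor <;> simp <;> linarith

theorem abs_card_dvd_dvd_add_sub_div_le_one {a b : ℕ} (ha : 0 < a) (hb : 0 < b)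
    (hab : a.Coprime b) (d x : ℕ) :
    |(((Finset.range x).filter (fun n => a ∣ n ∧ b ∣ n + d)).card : ℝ) - x / (a * b : ℕ)| ≤ 1 := by
  obtain ⟨c, hc1, hc2⟩ := Nat.chineseRemainder hab 0 (d * (b - 1))
  have hcd : b ∣ c + d := by
    have : c + d ≡ d * (b - 1) + d [MOD b] := hc2.add_right d
    rw [← Nat.modEq_zero_iff_dvd]
    refine this.trans ?_
    have : d * (b - 1) + d = d * b := by
      obtain ⟨k, rfl⟩ : ∃ k, b = k + 1 := ⟨b - 1, by omega⟩
      simp; ring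
    rw [this, Nat.modEq_zero_iff_dvd]
    exact dvd_mul_left _ _
  have hca : a ∣ c := (Nat.modEq_zero_iff_dvd).1 hc1
  convert abs_count_modEq_sub_div_le_one (Nat.mul_pos ha hb) x c using 5
  refine Finset.filter_congr fun n _ => ?_
  rw [← Nat.modEq_and_modEq_iff_modEq_mul hab]
  constructor
  · rintro ⟨h1, h2⟩
    refine ⟨((Nat.modEq_zero_iff_dvd).2 h1).trans ((Nat.modEq_zero_iff_dvd).2 hca).symm, ?_⟩
    exact Nat.ModEq.add_right_cancel' d
      (((Nat.modEq_zero_iff_dvd).2 h2).trans ((Nat.modEq_zero_iff_dvd).2 hcd).symm)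
  · rintro ⟨h1, h2⟩
    exact ⟨(Nat.modEq_zero_iff_dvd).1 (h1.trans ((Nat.modEq_zero_iff_dvd).2 hca)),
      (Nat.modEq_zero_iff_dvd).1 ((h2.add_right d).trans ((Nat.modEq_zero_iff_dvd).2 hcd))⟩

theorem prod_primes_dvd_iff {U : Finset ℕ} (hU : ∀ p ∈ U, p.Prime) (n : ℕ) :
    ∏ p ∈ U, p ∣ n ↔ ∀ p ∈ U, p ∣ n := by
  constructor
  · intro h p hp
    exact (Finset.dvd_prod_of_mem _ hp).trans h
  · intro h
    exact Finset.prod_primes_dvd n (fun p hp => (hU p hp).prime) h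

/-- Among `n < x`, the number of those for which every `p ∈ T` divides `n * (n + d)` is close to
its expected value. -/
theorem abs_card_forall_dvd_or_dvd_add_sub_le {T : Finset ℕ} (hT : ∀ p ∈ T, p.Prime) {d : ℕ}
    (hd : ∀ p ∈ T, ¬ p ∣ d) (x : ℕ) :
    |(((Finset.range x).filter (fun n => ∀ p ∈ T, p ∣ n ∨ p ∣ n + d)).card : ℝ)
      - x * ∏ p ∈ T, (2 / p : ℝ)| ≤ 2 ^ T.card := by
  classical
  have key : (((Finset.range x).filter (fun n => ∀ p ∈ T, p ∣ n ∨ p ∣ n + d)).card : ℝ)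
      = ∑ U ∈ T.powerset, (((Finset.range x).filter
          (fun n => ∏ p ∈ U, p ∣ n ∧ ∏ p ∈ T \ U, p ∣ n + d)).card : ℝ) := by
    have h1 : ∀ n, (if ∀ p ∈ T, p ∣ n ∨ p ∣ n + d then (1 : ℝ) else 0)
        = ∑ U ∈ T.powerset, if ∏ p ∈ U, p ∣ n ∧ ∏ p ∈ T \ U, p ∣ n + d then (1 : ℝ) else 0 := by
      intro n
      have h2 : (if ∀ p ∈ T, p ∣ n ∨ p ∣ n + d then (1 : ℝ) else 0)
          = ∏ p ∈ T, ((if p ∣ n then (1 : ℝ) else 0) + if p ∣ n + d then (1 : ℝ) else 0) := by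
        have h3 : (if ∀ p ∈ T, p ∣ n ∨ p ∣ n + d then (1 : ℝ) else 0)
            = ∏ p ∈ T, if p ∣ n ∨ p ∣ n + d then (1 : ℝ) else 0 := by
          rw [Finset.prod_ite_zero, Finset.prod_const_one]
        rw [h3]
        refine Finset.prod_congr rfl fun p hp => ?_
        have := hd p hp
        by_cases h1 : p ∣ n <;> by_cases h2 : p ∣ n + d <;> simp [h1, h2]
        exact this ((Nat.dvd_add_right h1).1 h2)
      rw [h2, Finset.prod_add]
      refine Finset.sum_congr rfl fun U hU => ?_
      rw [Finset.mem_powerset] at hU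
      simp only [prod_primes_dvd_iff (fun p hp => hT p (hU hp)),
        prod_primes_dvd_iff (fun p hp => hT p (Finset.sdiff_subset hp)), ite_and,
        Finset.prod_ite_zero, Finset.prod_const_one, ite_mul, one_mul, zero_mul]
    simp only [Finset.card_filter, Nat.cast_sum, Nat.cast_ite, Nat.cast_one, Nat.cast_zero]
    rw [Finset.sum_comm]
    exact Finset.sum_congr rfl fun n _ => h1 n
  have hmain : x * ∏ p ∈ T, (2 / p : ℝ) = ∑ U ∈ T.powerset, (x : ℝ) / (∏ p ∈ T, p : ℕ) := by
    rw [Finset.sum_const, Finset.card_powerset, Finset.prod_div_distrib, Finset.prod_const,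
      nsmul_eq_mul]
    push_cast
    ring
  rw [key, hmain, ← Finset.sum_sub_distrib]
  refine (Finset.abs_sum_le_sum_abs _ _).trans ?_
  have : ∀ U ∈ T.powerset, |(((Finset.range x).filter
          (fun n => ∏ p ∈ U, p ∣ n ∧ ∏ p ∈ T \ U, p ∣ n + d)).card : ℝ)
          - (x : ℝ) / (∏ p ∈ T, p : ℕ)| ≤ 1 := by
    intro U hU
    rw [Finset.mem_powerset] at hU
    rw [← Finset.prod_sdiff hU, mul_comm]
    refine abs_card_dvd_dvd_add_sub_div_le_one
      (Finset.prod_pos fun p hp => (hT p (hU hp)).pos)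
      (Finset.prod_pos fun p hp => (hT p (Finset.sdiff_subset hp)).pos) ?_ d x
    refine Nat.Coprime.prod_left fun p hp => Nat.Coprime.prod_right fun q hq => ?_
    rw [Nat.coprime_primes (hT p (hU hp)) (hT q (Finset.sdiff_subset hq))]
    rintro rfl
    exact (Finset.mem_sdiff.1 hq).2 hp
  refine (Finset.sum_le_sum this).trans ?_
  simp

theorem sum_powerset_filter_card_le {ι : Type*} (B : Finset ι) (k : ℕ) (f : ℕ → ℝ) :
    ∑ T ∈ B.powerset.filter (fun T => T.card ≤ k), f T.card
      = ∑ j ∈ Finset.range (k + 1), f j * (B.card.choose j : ℝ) := by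
  classical
  rw [← Finset.sum_fiberwise_of_maps_to (t := Finset.range (k + 1)) (g := Finset.card)]
  · refine Finset.sum_congr rfl fun j hj => ?_
    have : ((B.powerset.filter (fun T => T.card ≤ k)).filter (fun T => T.card = j))
        = B.powersetCard j := by
      ext T
      simp only [Finset.mem_filter, Finset.mem_powerset, Finset.mem_powersetCard,
        Finset.mem_range] at *
      constructor
      · rintro ⟨⟨a, b⟩, c⟩; exact ⟨a, c⟩
      · rintro ⟨a, c⟩; exact ⟨⟨a, by omega⟩, c⟩
    rw [this, Finset.sum_congr rfl (g := fun _ => f j), Finset.sum_const,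
      Finset.card_powersetCard, nsmul_eq_mul, mul_comm]
    intro T hT
    rw [(Finset.mem_powersetCard.1 hT).2]
  · intro T hT
    simp at hT ⊢
    omega

theorem sum_powerset_filter_card_le_two_pow_le {ι : Type*} (B : Finset ι) (k : ℕ) :
    ∑ T ∈ B.powerset.filter (fun T => T.card ≤ k), (2 : ℝ) ^ T.card ≤ (2 * B.card + 1) ^ k := by
  rw [sum_powerset_filter_card_le B k (fun j => 2 ^ j), add_pow]
  refine Finset.sum_le_sum fun j hj => ?_
  have h1 : (B.card.choose j : ℝ) ≤ (B.card : ℝ) ^ j := by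
    exact_mod_cast Nat.choose_le_pow B.card j
  have h2 : (1 : ℝ) ≤ k.choose j := by
    exact_mod_cast Nat.choose_pos (Nat.lt_succ_iff.1 (Finset.mem_range.1 hj))
  rw [one_pow, mul_one, mul_pow]
  calc (2 : ℝ) ^ j * B.card.choose j ≤ 2 ^ j * (B.card : ℝ) ^ j := by gcongr
    _ ≤ _ := le_mul_of_one_le_right (by positivity) h2

theorem bonferroni_even {ι : Type*} [DecidableEq ι] (B : Finset ι) {k : ℕ} (hk : Even k) :
    (if B = ∅ then (1 : ℝ) else 0) ≤
      ∑ T ∈ B.powerset.filter (fun T => T.card ≤ k), (-1 : ℝ) ^ T.card := by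
  rw [sum_powerset_filter_card_le B k (fun j => (-1) ^ j)]
  rcases B.eq_empty_or_nonempty with rfl | hB
  · rw [Finset.sum_eq_single 0]
    · simp
    · intro j _ hj
      obtain ⟨i, rfl⟩ := Nat.exists_eq_succ_of_ne_zero hj
      simp
    · simp
  · obtain ⟨b, hb⟩ := Nat.exists_eq_succ_of_ne_zero (Finset.card_ne_zero.2 hB)
    have := @Int.alternating_sum_range_choose_eq_choose b k
    have h2 : ∑ j ∈ Finset.range (k + 1), (-1 : ℝ) ^ j * (B.card.choose j : ℝ)
      = (b.choose k : ℝ) := by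
      rw [hk.neg_one_pow, one_mul] at this
      rw [hb]
      exact_mod_cast this
    rw [h2, if_neg hB.ne_empty]
    positivity

/-- Brun's pure sieve for the pair of residue classes `0, -d`. -/
theorem brun_pure_sieve {Q : Finset ℕ} (hQ : ∀ p ∈ Q, p.Prime) {d : ℕ} (hd : ∀ p ∈ Q, ¬ p ∣ d)
    (x : ℕ) {k : ℕ} (hk : Even k) :
    (((Finset.range x).filter (fun n => ∀ p ∈ Q, ¬ p ∣ n ∧ ¬ p ∣ n + d)).card : ℝ) ≤
      x * (∏ p ∈ Q, (1 - 2 / p : ℝ) + ∑ T ∈ Q.powerset.filter (fun T => ¬ T.card ≤ k),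
        ∏ p ∈ T, (2 / p : ℝ)) + ∑ T ∈ Q.powerset.filter (fun T => T.card ≤ k), 2 ^ T.card := by
  classical
  have h1 : (((Finset.range x).filter (fun n => ∀ p ∈ Q, ¬ p ∣ n ∧ ¬ p ∣ n + d)).card : ℝ) ≤
      ∑ T ∈ Q.powerset.filter (fun T => T.card ≤ k), (-1 : ℝ) ^ T.card *
        ((Finset.range x).filter (fun n => ∀ p ∈ T, p ∣ n ∨ p ∣ n + d)).card := by
    simp only [Finset.card_filter, Nat.cast_sum, Nat.cast_ite, Nat.cast_one, Nat.cast_zero,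
      Finset.mul_sum]
    rw [Finset.sum_comm]
    refine Finset.sum_le_sum fun n _ => ?_
    have hb := bonferroni_even (Q.filter (fun p => p ∣ n ∨ p ∣ n + d)) hk
    simp only [Finset.filter_eq_empty_iff, not_or] at hb
    refine le_of_eq_of_le ?_ (hb.trans_eq ?_)
    · congr
    · simp only [mul_ite, mul_one, mul_zero]
      rw [← Finset.sum_filter]
      refine Finset.sum_congr ?_ fun _ _ => rfl
      ext T
      simp only [Finset.mem_filter, Finset.mem_powerset, Finset.subset_iff]
      constructor
      · rintro ⟨a, b⟩; exact ⟨⟨fun p hp => (a hp).1, b⟩, fun p hp => (a hp).2⟩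
      · rintro ⟨⟨a, b⟩, c⟩; exact ⟨fun p hp => ⟨a hp, c p hp⟩, b⟩
  have h2 : ∑ T ∈ Q.powerset.filter (fun T => T.card ≤ k), (-1 : ℝ) ^ T.card *
        ((Finset.range x).filter (fun n => ∀ p ∈ T, p ∣ n ∨ p ∣ n + d)).card ≤
      ∑ T ∈ Q.powerset.filter (fun T => T.card ≤ k),
        (x * ((-1 : ℝ) ^ T.card * ∏ p ∈ T, (2 / p : ℝ)) + 2 ^ T.card) := by
    refine Finset.sum_le_sum fun T hT => ?_
    have hTQ : T ⊆ Q := Finset.mem_powerset.1 (Finset.mem_filter.1 hT).1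
    have := abs_le.1 (abs_card_forall_dvd_or_dvd_add_sub_le (fun p hp => hQ p (hTQ hp))
      (fun p hp => hd p (hTQ hp)) x)
    rcases neg_one_pow_eq_or ℝ T.card with h | h <;> rw [h] <;> linarith [this.1, this.2]
  refine (h1.trans h2).trans ?_
  rw [Finset.sum_add_distrib, ← Finset.mul_sum]
  gcongr
  have h3 : ∏ p ∈ Q, (1 - 2 / p : ℝ)
      = ∑ T ∈ Q.powerset, (-1 : ℝ) ^ T.card * ∏ p ∈ T, (2 / p : ℝ) := by
    rw [show ∏ p ∈ Q, (1 - 2 / p : ℝ) = ∏ p ∈ Q, (1 + -(2 / p : ℝ)) by simp [sub_eq_add_neg],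
      Finset.prod_one_add]
    refine Finset.sum_congr rfl fun T _ => ?_
    rw [Finset.prod_neg]
  rw [h3, ← Finset.sum_filter_add_sum_filter_not Q.powerset (fun T => T.card ≤ k), add_assoc,
    ← Finset.sum_add_distrib]
  refine le_add_of_nonneg_right (Finset.sum_nonneg fun T _ => ?_)
  have : 0 ≤ ∏ p ∈ T, (2 / p : ℝ) := Finset.prod_nonneg fun p _ => by positivity
  rcases neg_one_pow_eq_or ℝ T.card with h | h <;> rw [h] <;> linarith

theorem sum_powerset_filter_lt_card_prod_le (Q : Finset ℕ) (k : ℕ) :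
    ∑ T ∈ Q.powerset.filter (fun T => ¬ T.card ≤ k), ∏ p ∈ T, (2 / p : ℝ) ≤
      Real.exp (-k) * Real.exp (6 * ∑ p ∈ Q, (1 / p : ℝ)) := by
  have h1 : ∀ T ∈ Q.powerset.filter (fun T => ¬ T.card ≤ k), ∏ p ∈ T, (2 / p : ℝ) ≤
      Real.exp (-k) * ∏ p ∈ T, (6 / p : ℝ) := by
    intro T hT
    have hk : k < T.card := not_le.1 (Finset.mem_filter.1 hT).2
    have h3 : Real.exp 1 ≤ 3 := Real.exp_one_lt_three.le
    have h : ∏ p ∈ T, (6 / p : ℝ) = 3 ^ T.card * ∏ p ∈ T, (2 / p : ℝ) := by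
      rw [← Finset.prod_const, ← Finset.prod_mul_distrib]
      exact Finset.prod_congr rfl fun p _ => by ring
    rw [h, ← mul_assoc]
    refine le_mul_of_one_le_left (Finset.prod_nonneg fun p _ => by positivity) ?_
    calc (1 : ℝ) ≤ Real.exp (-k) * Real.exp 1 ^ T.card := by
          rw [← Real.exp_nat_mul, ← Real.exp_add]
          apply Real.one_le_exp
          have : (k : ℝ) ≤ T.card := by exact_mod_cast hk.le
          linarith
      _ ≤ _ := by gcongr
  calc _ ≤ ∑ T ∈ Q.powerset.filter (fun T => ¬ T.card ≤ k),
          Real.exp (-k) * ∏ p ∈ T, (6 / p : ℝ) := Finset.sum_le_sum h1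
    _ ≤ ∑ T ∈ Q.powerset, Real.exp (-k) * ∏ p ∈ T, (6 / p : ℝ) :=
        Finset.sum_le_sum_of_subset_of_nonneg (Finset.filter_subset _ _) fun T _ _ => by positivity
    _ = Real.exp (-k) * ∏ p ∈ Q, (1 + 6 / p : ℝ) := by
        rw [← Finset.mul_sum, Finset.prod_one_add]
    _ ≤ _ := by
        rw [Finset.mul_sum, Real.exp_sum]
        gcongr with p hp
        have := Real.add_one_le_exp (6 * (1 / p : ℝ))
        linarith [show 6 * (1 / p : ℝ) = 6 / p by ring]

theorem brun_pure_sieve_exp {Q : Finset ℕ} (hQ : ∀ p ∈ Q, p.Prime) {d : ℕ}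
    (hd : ∀ p ∈ Q, ¬ p ∣ d) (x : ℕ) {k : ℕ} (hk : Even k) :
    (((Finset.range x).filter (fun n => ∀ p ∈ Q, ¬ p ∣ n ∧ ¬ p ∣ n + d)).card : ℝ) ≤
      x * ((∏ p ∈ Q, (1 - 1 / p : ℝ)) ^ 2
        + Real.exp (-k) * Real.exp (6 * ∑ p ∈ Q, (1 / p : ℝ))) + (2 * Q.card + 1) ^ k := by
  refine (brun_pure_sieve hQ hd x hk).trans ?_
  have h : ∏ p ∈ Q, (1 - 2 / p : ℝ) ≤ (∏ p ∈ Q, (1 - 1 / p : ℝ)) ^ 2 := by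
    rw [← Finset.prod_pow]
    refine Finset.prod_le_prod (fun p hp => ?_) (fun p hp => ?_)
    · have : (2 : ℝ) ≤ p := by exact_mod_cast (hQ p hp).two_le
      rw [sub_nonneg, div_le_one (by linarith)]
      exact this
    · have : (1 - 1 / p : ℝ) ^ 2 = 1 - 2 / p + (1 / p) ^ 2 := by ring
      rw [this]
      linarith [sq_nonneg (1 / p : ℝ)]
  gcongr
  · exact sum_powerset_filter_lt_card_prod_le Q k
  · exact sum_powerset_filter_card_le_two_pow_le Q k

theorem log_le_prod_primesBelow (N : ℕ) :
    Real.log N ≤ ∏ p ∈ N.primesBelow, (1 - 1 / p : ℝ)⁻¹ := by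
  rcases N with - | N
  · simp
  let f : ℕ →* ℝ := ⟨⟨fun n => (n : ℝ)⁻¹, by simp⟩, fun a b => by simp [mul_comm]⟩
  have hf : ∀ {p : ℕ}, p.Prime → ‖f p‖ < 1 := by
    intro p hp
    have : (1 : ℝ) < p := by exact_mod_cast hp.one_lt
    simpa [f] using inv_lt_one_of_one_lt₀ this
  have h := (EulerProduct.summable_and_hasSum_smoothNumbers_prod_primesBelow_geometric hf
    (N + 1)).2
  have e : ∏ p ∈ (N + 1).primesBelow, (1 - 1 / p : ℝ)⁻¹
      = ∏ p ∈ (N + 1).primesBelow, (1 - f p)⁻¹ := by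
    simp [f]
  rw [e]
  have hsub : ∀ n ∈ Finset.Icc 1 N, n ∈ Nat.smoothNumbers (N + 1) := by
    intro n hn
    rw [Finset.mem_Icc] at hn
    exact Nat.mem_smoothNumbers_of_lt hn.1 (by omega)
  have h2 : ∑ n ∈ Finset.Icc 1 N, (n : ℝ)⁻¹ ≤ ∏ p ∈ (N + 1).primesBelow, (1 - f p)⁻¹ := by
    rw [← Finset.sum_subtype_of_mem (fun n : ℕ => (n : ℝ)⁻¹) hsub]
    exact sum_le_hasSum _ (fun i _ => by simp) h
  refine le_trans ?_ h2
  have := log_add_one_le_harmonic N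
  rw [harmonic_eq_sum_Icc] at this
  push_cast at this ⊢
  exact this

theorem sum_primesBelow_two_pow_le (J : ℕ) :
    ∑ p ∈ Nat.primesBelow (2 ^ J), (1 / p : ℝ) ≤ ∑ j ∈ Finset.range J, (4 / j : ℝ) := by
  induction J with
  | zero => simp
  | succ J ih =>
    rw [Finset.sum_range_succ]
    rcases Nat.eq_zero_or_pos J with rfl | hJ
    · simp [Nat.primesBelow_succ, Nat.not_prime_one, Nat.not_prime_zero]
    have hsub : Nat.primesBelow (2 ^ J) ⊆ Nat.primesBelow (2 ^ (J + 1)) := by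
      intro p hp
      rw [Nat.mem_primesBelow] at *
      exact ⟨hp.1.trans (Nat.pow_lt_pow_right (by norm_num) (by omega)), hp.2⟩
    rw [← Finset.sum_sdiff hsub, add_comm]
    refine add_le_add ih ?_
    set D := Nat.primesBelow (2 ^ (J + 1)) \ Nat.primesBelow (2 ^ J) with hD
    have hDp : ∀ p ∈ D, 2 ^ J ≤ p ∧ p < 2 ^ (J + 1) ∧ p.Prime := by
      intro p hp
      simp only [hD, Finset.mem_sdiff, Nat.mem_primesBelow, not_and] at hp
      exact ⟨not_lt.1 fun h => hp.2 h hp.1.2, hp.1⟩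
    have h1 : (2 ^ J) ^ D.card ≤ 4 ^ (2 ^ (J + 1)) := by
      calc (2 ^ J) ^ D.card ≤ ∏ p ∈ D, p := Finset.pow_card_le_prod _ _ _ fun p hp => (hDp p hp).1
        _ ≤ primorial (2 ^ (J + 1)) := by
          unfold primorial
          refine Finset.prod_le_prod_of_subset_of_one_le' ?_ ?_
          · intro p hp
            have := hDp p hp
            simp only [Finset.mem_filter, Finset.mem_range]
            exact ⟨by omega, this.2.2⟩
          · intro p hp _
            exact (Finset.mem_filter.1 hp).2.one_le
        _ ≤ _ := primorial_le_four_pow _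
    have h2 : J * D.card ≤ 4 * 2 ^ J := by
      rw [← pow_mul, show (4 : ℕ) = 2 ^ 2 by norm_num, ← pow_mul] at h1
      have := (Nat.pow_le_pow_iff_right (by norm_num)).1 h1
      calc _ ≤ _ := this
        _ = _ := by ring
    have h2' : (J : ℝ) * D.card ≤ 4 * 2 ^ J := by exact_mod_cast h2
    have hJ' : (0 : ℝ) < J := by exact_mod_cast hJ
    calc ∑ p ∈ D, (1 / p : ℝ) ≤ ∑ p ∈ D, (1 / 2 ^ J : ℝ) := by
          refine Finset.sum_le_sum fun p hp => ?_
          have : (2 ^ J : ℝ) ≤ p := by exact_mod_cast (hDp p hp).1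
          gcongr
      _ = D.card / 2 ^ J := by simp [div_eq_mul_inv]
      _ ≤ 4 / J := by
          rw [div_le_div_iff₀ (by positivity) hJ']
          linarith

/-- An upper bound of the right order of magnitude for the sum of reciprocals of primes. -/
theorem sum_primesBelow_one_div_le {y : ℕ} (hy : 1 ≤ y) :
    ∑ p ∈ y.primesBelow, (1 / p : ℝ) ≤ 4 * (1 + Real.log (1 + 2 * Real.log y)) := by
  set J := Nat.log 2 y with hJ
  have hyJ : y < 2 ^ (J + 1) := Nat.lt_pow_succ_log_self (by norm_num) y
  have hJy : 2 ^ J ≤ y := Nat.pow_log_le_self 2 (by omega)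
  have hsub : y.primesBelow ⊆ Nat.primesBelow (2 ^ (J + 1)) := by
    intro p hp
    rw [Nat.mem_primesBelow] at *
    exact ⟨hp.1.trans hyJ, hp.2⟩
  refine (Finset.sum_le_sum_of_subset_of_nonneg hsub fun p _ _ => by positivity).trans ?_
  refine (sum_primesBelow_two_pow_le _).trans ?_
  have h1 : ∑ j ∈ Finset.range (J + 1), (4 / j : ℝ) = 4 * (harmonic J : ℝ) := by
    rw [Finset.sum_range_succ', harmonic]
    push_cast
    simp [Finset.mul_sum, div_eq_mul_inv]
  rw [h1]
  have h2 : (harmonic J : ℝ) ≤ 1 + Real.log J := harmonic_le_one_add_log J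
  have h3 : (J : ℝ) ≤ 2 * Real.log y := by
    have : (2 : ℝ) ^ J ≤ y := by exact_mod_cast hJy
    have h := Real.log_le_log (by positivity) this
    rw [Real.log_pow] at h
    have h2 := Real.log_two_gt_d9
    have : (0 : ℝ) ≤ J := by positivity
    nlinarith
  have h4 : Real.log J ≤ Real.log (1 + 2 * Real.log y) := by
    rcases Nat.eq_zero_or_pos J with h | h
    · rw [h] at h3 ⊢
      simp only [Nat.cast_zero, Real.log_zero]
      apply Real.log_nonneg
      push_cast at h3
      linarith
    · apply Real.log_le_log (by exact_mod_cast h)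
      linarith
  linarith

theorem sum_large_primeFactors_one_div_le {d x y : ℕ} (hd : d ≠ 0) (hdx : d ≤ x) (hy : 0 < y)
    (hxy : Real.log x ≤ y) :
    ∑ p ∈ d.primeFactors.filter (fun p => y ≤ p), (1 / p : ℝ) ≤ 2 := by
  have hy' : (0 : ℝ) < y := by exact_mod_cast hy
  have h1 : 2 ^ d.primeFactors.card ≤ x := by
    calc 2 ^ d.primeFactors.card ≤ ∏ p ∈ d.primeFactors, p :=
          Finset.pow_card_le_prod _ _ _ fun p hp => (Nat.prime_of_mem_primeFactors hp).two_le
      _ ≤ d := Nat.le_of_dvd (Nat.pos_of_ne_zero hd) (Nat.prod_primeFactors_dvd d)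
      _ ≤ x := hdx
  have h2 : (d.primeFactors.card : ℝ) ≤ 2 * y := by
    have : (2 : ℝ) ^ d.primeFactors.card ≤ x := by exact_mod_cast h1
    have h := Real.log_le_log (by positivity) this
    rw [Real.log_pow] at h
    have h2 := Real.log_two_gt_d9
    have : (0 : ℝ) ≤ d.primeFactors.card := by positivity
    nlinarith
  calc ∑ p ∈ d.primeFactors.filter (fun p => y ≤ p), (1 / p : ℝ)
      ≤ ∑ p ∈ d.primeFactors.filter (fun p => y ≤ p), (1 / y : ℝ) := by
        refine Finset.sum_le_sum fun p hp => ?_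
        have : (y : ℝ) ≤ p := by exact_mod_cast (Finset.mem_filter.1 hp).2
        gcongr
    _ = (d.primeFactors.filter (fun p => y ≤ p)).card / y := by simp [div_eq_mul_inv]
    _ ≤ d.primeFactors.card / y := by
        gcongr
        exact Finset.filter_subset _ _
    _ ≤ 2 := by rw [div_le_iff₀ hy']; exact h2

theorem prod_sifting_primes_le {d x y z : ℕ} (hd : d ≠ 0) (hdx : d ≤ x) (hy : 1 ≤ y)
    (hz : 2 ≤ z) (hxy : Real.log x ≤ y) :
    ∏ p ∈ z.primesBelow.filter (fun p => y ≤ p ∧ ¬ p ∣ d), (1 - 1 / p : ℝ) ≤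
      Real.exp 12 * (1 + 2 * Real.log y) ^ 8 / Real.log z := by
  have hlogz : 0 < Real.log z := Real.log_pos (by exact_mod_cast hz)
  have hlogy : 0 ≤ Real.log y := Real.log_nonneg (by exact_mod_cast hy)
  set R := z.primesBelow.filter (fun p => ¬ (y ≤ p ∧ ¬ p ∣ d)) with hR
  have hRp : ∀ p ∈ R, p.Prime := fun p hp =>
    Nat.prime_of_mem_primesBelow (Finset.mem_filter.1 hp).1
  have hRsum : ∑ p ∈ R, (1 / p : ℝ) ≤ 4 * (1 + Real.log (1 + 2 * Real.log y)) + 2 := by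
    rw [← Finset.sum_filter_add_sum_filter_not R (fun p => p < y)]
    refine add_le_add ?_ ?_
    · refine le_trans ?_ (sum_primesBelow_one_div_le hy)
      refine Finset.sum_le_sum_of_subset_of_nonneg ?_ fun p _ _ => by positivity
      intro p hp
      rw [Finset.mem_filter] at hp
      exact Nat.mem_primesBelow.2 ⟨hp.2, hRp p hp.1⟩
    · refine le_trans ?_ (sum_large_primeFactors_one_div_le hd hdx hy hxy)
      refine Finset.sum_le_sum_of_subset_of_nonneg ?_ fun p _ _ => by positivity
      intro p hp
      simp only [hR, Finset.mem_filter, Nat.mem_primesBelow, not_and, not_not, not_lt] at hp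
      rw [Finset.mem_filter, Nat.mem_primeFactors]
      exact ⟨⟨hp.1.1.2, hp.1.2 hp.2, hd⟩, hp.2⟩
  have hRprod : ∏ p ∈ R, (1 - 1 / p : ℝ)⁻¹ ≤ Real.exp 12 * (1 + 2 * Real.log y) ^ 8 := by
    calc ∏ p ∈ R, (1 - 1 / p : ℝ)⁻¹ ≤ ∏ p ∈ R, Real.exp (2 * (1 / p : ℝ)) := by
          refine Finset.prod_le_prod (fun p hp => ?_) (fun p hp => ?_)
          · have : (2 : ℝ) ≤ p := by exact_mod_cast (hRp p hp).two_le
            rw [inv_nonneg, sub_nonneg, div_le_one (by linarith)]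
            linarith
          · have : (2 : ℝ) ≤ p := by exact_mod_cast (hRp p hp).two_le
            refine le_trans ?_ (Real.add_one_le_exp _)
            have h1 : (1 / p : ℝ) ≤ 1 / 2 := by gcongr
            have h0 : 0 ≤ (1 / p : ℝ) := by positivity
            rw [inv_le_comm₀ (by linarith) (by linarith), inv_le_iff_one_le_mul₀ (by linarith)]
            nlinarith
      _ = Real.exp (2 * ∑ p ∈ R, (1 / p : ℝ)) := by rw [Finset.mul_sum, Real.exp_sum]
      _ ≤ Real.exp (12 + 8 * Real.log (1 + 2 * Real.log y)) := by
          apply Real.exp_le_exp.2; linarith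
      _ = _ := by
          rw [Real.exp_add, show 8 * Real.log (1 + 2 * Real.log y)
            = ((8 : ℕ) : ℝ) * Real.log (1 + 2 * Real.log y) by norm_num, Real.exp_nat_mul,
            Real.exp_log (by linarith)]
  set q := ∏ p ∈ z.primesBelow.filter (fun p => y ≤ p ∧ ¬ p ∣ d), (1 - 1 / p : ℝ) with hq
  have hqpos : 0 < q := by
    refine Finset.prod_pos fun p hp => ?_
    have : (1 : ℝ) < p := by
      exact_mod_cast (Nat.prime_of_mem_primesBelow (Finset.mem_filter.1 hp).1).one_lt
    rw [sub_pos, div_lt_one (by linarith)]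
    exact this
  have h := log_le_prod_primesBelow z
  rw [← Finset.prod_filter_mul_prod_filter_not z.primesBelow (fun p => y ≤ p ∧ ¬ p ∣ d),
    Finset.prod_inv_distrib, ← hq] at h
  rw [le_div_iff₀ hlogz]
  calc q * Real.log z ≤ q * (q⁻¹ * ∏ p ∈ R, (1 - 1 / p : ℝ)⁻¹) := by gcongr
    _ = ∏ p ∈ R, (1 - 1 / p : ℝ)⁻¹ := by field_simp
    _ ≤ _ := hRprod

/-- An upper bound, uniform in `d`, for the number of prime pairs `(n, n + d)`. -/
theorem card_prime_pairs_le {d x y z k : ℕ} (hd : d ≠ 0) (hdx : d ≤ x) (hy : 1 ≤ y)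
    (hz : 2 ≤ z) (hxy : Real.log x ≤ y) (hk : Even k) :
    (((Finset.range x).filter (fun n => n.Prime ∧ (n + d).Prime)).card : ℝ) ≤
      z + (x * (Real.exp 24 * (1 + 2 * Real.log y) ^ 16 / Real.log z ^ 2
        + Real.exp (-k) * (Real.exp 24 * (1 + 2 * Real.log z) ^ 24)) + (2 * z + 1) ^ k) := by
  set Q := z.primesBelow.filter (fun p => y ≤ p ∧ ¬ p ∣ d) with hQ
  have hQz : Q ⊆ z.primesBelow := Finset.filter_subset _ _
  have hQp : ∀ p ∈ Q, p.Prime := fun p hp => Nat.prime_of_mem_primesBelow (hQz hp)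
  have hQd : ∀ p ∈ Q, ¬ p ∣ d := fun p hp => (Finset.mem_filter.1 hp).2.2
  have hlogz : 0 < Real.log z := Real.log_pos (by exact_mod_cast hz)
  have hsub : (Finset.range x).filter (fun n => n.Prime ∧ (n + d).Prime) ⊆
      Finset.range z ∪ (Finset.range x).filter (fun n => ∀ p ∈ Q, ¬ p ∣ n ∧ ¬ p ∣ n + d) := by
    intro n hn
    rw [Finset.mem_filter, Finset.mem_range] at hn
    rw [Finset.mem_union, Finset.mem_range, Finset.mem_filter, Finset.mem_range]
    by_cases hnz : n < z
    · exact Or.inl hnz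
    refine Or.inr ⟨hn.1, fun p hp => ?_⟩
    have hpz := Nat.lt_of_mem_primesBelow (hQz hp)
    constructor
    · intro h
      have := (Nat.prime_dvd_prime_iff_eq (hQp p hp) hn.2.1).1 h
      omega
    · intro h
      have := (Nat.prime_dvd_prime_iff_eq (hQp p hp) hn.2.2).1 h
      omega
  have hcard := (Finset.card_le_card hsub).trans (Finset.card_union_le _ _)
  rw [Finset.card_range] at hcard
  have hcard' : (((Finset.range x).filter (fun n => n.Prime ∧ (n + d).Prime)).card : ℝ) ≤ z +
      ((Finset.range x).filter (fun n => ∀ p ∈ Q, ¬ p ∣ n ∧ ¬ p ∣ n + d)).card := by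
    exact_mod_cast hcard
  refine hcard'.trans (add_le_add le_rfl ((brun_pure_sieve_exp hQp hQd x hk).trans ?_))
  have hq0 : 0 ≤ ∏ p ∈ Q, (1 - 1 / p : ℝ) := by
    refine Finset.prod_nonneg fun p hp => ?_
    have : (1 : ℝ) < p := by exact_mod_cast (hQp p hp).one_lt
    rw [sub_nonneg, div_le_one (by linarith)]
    exact this.le
  have hQcard : Q.card ≤ z := by
    refine (Finset.card_le_card (t := Finset.range z) fun p hp => ?_).trans_eq
      (Finset.card_range z)
    exact Finset.mem_range.2 (Nat.lt_of_mem_primesBelow (hQz hp))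
  gcongr ?_ * (?_ + ?_ * ?_) + ?_
  · calc (∏ p ∈ Q, (1 - 1 / p : ℝ)) ^ 2
        ≤ (Real.exp 12 * (1 + 2 * Real.log y) ^ 8 / Real.log z) ^ 2 := by
          gcongr
          exact prod_sifting_primes_le hd hdx hy hz hxy
      _ = _ := by
          rw [div_pow, mul_pow, ← pow_mul, ← Real.exp_nat_mul]
          norm_num
  · calc Real.exp (6 * ∑ p ∈ Q, (1 / p : ℝ))
        ≤ Real.exp (24 + ((24 : ℕ) : ℝ) * Real.log (1 + 2 * Real.log z)) := by
          apply Real.exp_le_exp.2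
          have h1 := sum_primesBelow_one_div_le (y := z) (by omega)
          have h2 : ∑ p ∈ Q, (1 / p : ℝ) ≤ ∑ p ∈ z.primesBelow, (1 / p : ℝ) :=
            Finset.sum_le_sum_of_subset_of_nonneg hQz fun p _ _ => by positivity
          push_cast
          linarith
      _ = _ := by
          rw [Real.exp_add, Real.exp_nat_mul, Real.exp_log (by linarith)]
  · have : (Q.card : ℝ) ≤ z := by exact_mod_cast hQcard
    gcongr

theorem tendsto_log_pow_div_rpow_atTop (n : ℕ) {a : ℝ} (ha : 0 < a) :
    Tendsto (fun L : ℝ => Real.log L ^ n / L ^ a) atTop (nhds 0) := by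
  have h := (isLittleO_log_rpow_rpow_atTop (n : ℝ) ha).tendsto_div_nhds_zero
  simpa only [Real.rpow_natCast] using h

theorem tendsto_mul_prime_pairs_bound :
    Tendsto (fun L : ℝ => L * (Real.exp 24 * (5 * Real.log L) ^ 16 / (L ^ (3 / 4 : ℝ)) ^ 2
      + (L ^ 26)⁻¹ * (Real.exp 24 * (3 * L) ^ 24) + 2 * Real.exp (-(L / 2)))) atTop (nhds 0) := by
  have h1 := (tendsto_log_pow_div_rpow_atTop 16 (a := 1 / 2) (by norm_num)).const_mul
    (Real.exp 24 * 5 ^ 16)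
  have h2 := (tendsto_inv_atTop_zero (𝕜 := ℝ)).const_mul (Real.exp 24 * 3 ^ 24)
  have h3 : Tendsto (fun L : ℝ => (L / 2) * Real.exp (-(L / 2))) atTop (nhds 0) := by
    have := (Real.tendsto_pow_mul_exp_neg_atTop_nhds_zero 1).comp
      (tendsto_id.atTop_div_const (show (0 : ℝ) < 2 by norm_num))
    simpa [Function.comp_def] using this
  have h := (h1.add h2).add (h3.const_mul 4)
  simp only [mul_zero, add_zero] at h
  refine h.congr' ?_
  filter_upwards [eventually_gt_atTop 0] with L hL
  have e : (L ^ (3 / 4 : ℝ)) ^ 2 = L * L ^ (1 / 2 : ℝ) := by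
    rw [← Real.rpow_natCast, ← Real.rpow_mul hL.le, ← Real.rpow_one_add' hL.le (by norm_num)]
    norm_num
  rw [e]
  have : 0 < L ^ (1 / 2 : ℝ) := by positivity
  field_simp
  ring

theorem eventually_log_mul_rpow_le :
    ∀ᶠ L : ℝ in atTop, (26 * Real.log L + 2) * (L ^ (3 / 4 : ℝ) + 2) ≤ L / 2 := by
  have h1 := (tendsto_log_pow_div_rpow_atTop 1 (a := 1 / 4) (by norm_num)).eventually_le_const
    (show (0 : ℝ) < 1 / 200 by norm_num)
  filter_upwards [h1, eventually_ge_atTop (3 : ℝ)] with L h hL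
  have hlog : 1 ≤ Real.log L := by
    rw [Real.le_log_iff_exp_le (by linarith)]
    exact Real.exp_one_lt_three.le.trans hL
  have hr : 1 ≤ L ^ (3 / 4 : ℝ) := Real.one_le_rpow (by linarith) (by norm_num)
  have hr' : 0 < L ^ (1 / 4 : ℝ) := by positivity
  rw [pow_one, div_le_iff₀ hr'] at h
  have e : L ^ (1 / 4 : ℝ) * L ^ (3 / 4 : ℝ) = L := by
    rw [← Real.rpow_add (by linarith)]; norm_num
  calc (26 * Real.log L + 2) * (L ^ (3 / 4 : ℝ) + 2)
      ≤ (28 * Real.log L) * (3 * L ^ (3 / 4 : ℝ)) := by gcongr <;> linarith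
    _ = 84 * (Real.log L * L ^ (3 / 4 : ℝ)) := by ring
    _ ≤ 84 * ((1 / 200 * L ^ (1 / 4 : ℝ)) * L ^ (3 / 4 : ℝ)) := by gcongr
    _ = 84 / 200 * (L ^ (1 / 4 : ℝ) * L ^ (3 / 4 : ℝ)) := by ring
    _ ≤ L / 2 := by rw [e]; linarith

theorem eventually_card_prime_pairs_le :
    ∀ᶠ L : ℝ in atTop, ∀ x d : ℕ, Real.log x = L → d ≠ 0 → d ≤ x →
      (((Finset.range x).filter (fun n => n.Prime ∧ (n + d).Prime)).card : ℝ) ≤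
      x * (Real.exp 24 * (5 * Real.log L) ^ 16 / (L ^ (3 / 4 : ℝ)) ^ 2
      + (L ^ 26)⁻¹ * (Real.exp 24 * (3 * L) ^ 24) + 2 * Real.exp (-(L / 2))) := by
  filter_upwards [eventually_log_mul_rpow_le, eventually_ge_atTop (3 : ℝ)]
    with L hL hL3 x d hx hd hdx
  have hlog : 1 ≤ Real.log L := by
    rw [Real.le_log_iff_exp_le (by linarith)]
    exact Real.exp_one_lt_three.le.trans hL3
  set u := L ^ (3 / 4 : ℝ) with hu
  have hu1 : 1 ≤ u := Real.one_le_rpow (by linarith) (by norm_num)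
  have huL : u ≤ L := by
    calc u ≤ L ^ (1 : ℝ) := Real.rpow_le_rpow_of_exponent_le (by linarith) (by norm_num)
      _ = L := Real.rpow_one L
  have hexL : Real.exp L = x := by
    rw [← hx, Real.exp_log]
    have : x ≠ 0 := by omega
    positivity
  set y := ⌈L⌉₊ with hy
  set z := ⌈Real.exp u⌉₊ with hz
  set k := 2 * ⌈13 * Real.log L⌉₊ with hk
  have hyL : L ≤ y := Nat.le_ceil L
  have hyL' : (y : ℝ) < L + 1 := Nat.ceil_lt_add_one (by linarith)
  have hy1 : 1 ≤ y := Nat.one_le_ceil_iff.2 (by linarith)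
  have hzu : Real.exp u ≤ z := Nat.le_ceil _
  have hzu' : (z : ℝ) < Real.exp u + 1 := Nat.ceil_lt_add_one (Real.exp_pos u).le
  have heu : 2 ≤ Real.exp u := by linarith [Real.add_one_le_exp u]
  have hz2 : 2 ≤ z := by exact_mod_cast heu.trans hzu
  have hk1 : 26 * Real.log L ≤ k := by
    have := Nat.le_ceil (13 * Real.log L)
    rw [hk]; push_cast; linarith
  have hk2 : (k : ℝ) ≤ 26 * Real.log L + 2 := by
    have := Nat.ceil_lt_add_one (show 0 ≤ 13 * Real.log L by linarith)
    rw [hk]; push_cast; linarith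
  have hlogy : 1 + 2 * Real.log y ≤ 5 * Real.log L := by
    have : Real.log y ≤ Real.log (L ^ 2) := by
      apply Real.log_le_log (by linarith)
      nlinarith
    rw [Real.log_pow] at this
    push_cast at this
    linarith
  have hlogy0 : 0 ≤ Real.log y := Real.log_nonneg (by exact_mod_cast hy1)
  have hlogz : u ≤ Real.log z := (Real.le_log_iff_exp_le (by linarith)).2 hzu
  have hlogz' : Real.log z ≤ u + 1 := by
    rw [Real.log_le_iff_le_exp (by linarith), Real.exp_add]
    have := Real.exp_one_gt_d9
    nlinarith
  have he2 : 5 ≤ Real.exp 2 := by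
    rw [show (2 : ℝ) = 1 + 1 by norm_num, Real.exp_add]
    have := Real.exp_one_gt_d9
    nlinarith
  have hz3 : 2 * (z : ℝ) + 1 ≤ Real.exp (u + 2) := by
    rw [Real.exp_add]
    nlinarith
  have hsmall : Real.exp (L / 2) = x * Real.exp (-(L / 2)) := by
    rw [← hexL, ← Real.exp_add]; congr 1; ring
  have hpow : (2 * (z : ℝ) + 1) ^ k ≤ Real.exp (L / 2) := by
    calc (2 * (z : ℝ) + 1) ^ k ≤ Real.exp (u + 2) ^ k := by gcongr
      _ = Real.exp (k * (u + 2)) := by rw [Real.exp_nat_mul]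
      _ ≤ _ := by
        apply Real.exp_le_exp.2
        refine le_trans ?_ hL
        gcongr
  have hzsmall : (z : ℝ) ≤ Real.exp (L / 2) := by
    refine (show (z : ℝ) ≤ Real.exp (u + 2) by linarith).trans (Real.exp_le_exp.2 ?_)
    nlinarith
  have hexpk : Real.exp (-k) ≤ (L ^ 26)⁻¹ := by
    calc Real.exp (-k) ≤ Real.exp (-(((26 : ℕ) : ℝ) * Real.log L)) := by
          apply Real.exp_le_exp.2; push_cast; linarith
      _ = _ := by rw [Real.exp_neg, Real.exp_nat_mul, Real.exp_log (by linarith)]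
  refine (card_prime_pairs_le hd hdx hy1 hz2 (hx.trans_le hyL)
    (k := k) (even_two_mul _)).trans ?_
  have hmain : Real.exp 24 * (1 + 2 * Real.log y) ^ 16 / Real.log z ^ 2
        + Real.exp (-k) * (Real.exp 24 * (1 + 2 * Real.log z) ^ 24) ≤
      Real.exp 24 * (5 * Real.log L) ^ 16 / u ^ 2
      + (L ^ 26)⁻¹ * (Real.exp 24 * (3 * L) ^ 24) := by
    gcongr
    linarith
  have hx0 : (0 : ℝ) ≤ x := by positivity
  have := mul_le_mul_of_nonneg_left hmain hx0
  linarith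

theorem eventually_half_le_primeCounting'_mul_log :
    ∀ᶠ x : ℕ in atTop, (x : ℝ) / 2 ≤ Nat.primeCounting' x * Real.log x := by
  have h := Real.isLittleO_log_id_atTop.bound (show (0 : ℝ) < 1 / 20 by norm_num)
  filter_upwards [tendsto_natCast_atTop_atTop.eventually h, eventually_ge_atTop 3] with x hx h3
  have hx3 : (3 : ℝ) ≤ x := by exact_mod_cast h3
  have hlog : 0 < Real.log x := Real.log_pos (by linarith)
  rw [id, Real.norm_of_nonneg hlog.le, Real.norm_of_nonneg (by linarith)] at hx
  have h1 := Chebyshev.pi_ge x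
  rw [div_le_iff₀ hlog] at h1
  have h2 : (Nat.primeCounting x : ℝ) ≤ Nat.primeCounting' x + 1 := by
    have : Nat.primeCounting x ≤ Nat.primeCounting' x + 1 := by
      unfold Nat.primeCounting Nat.primeCounting'
      rw [Nat.count_succ]
      split_ifs <;> omega
    exact_mod_cast this
  have h4 : Real.log (x + 1) ≤ 2 * Real.log x := by
    rw [show 2 * Real.log x = Real.log (x ^ 2) by rw [Real.log_pow]; norm_num]
    apply Real.log_le_log (by linarith)
    nlinarith
  have h5 := Real.log_two_gt_d9
  nlinarith

theorem eventually_card_prime_pairs_le_mul_primeCounting' {ε : ℝ} (hε : 0 < ε) :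
    ∀ᶠ x : ℕ in atTop, ∀ d : ℕ, d ≠ 0 → d ≤ x →
      (((Finset.range x).filter (fun n => n.Prime ∧ (n + d).Prime)).card : ℝ) ≤
      ε * Nat.primeCounting' x := by
  have hlog : Tendsto (fun x : ℕ => Real.log x) atTop atTop :=
    Real.tendsto_log_atTop.comp tendsto_natCast_atTop_atTop
  filter_upwards [hlog.eventually eventually_card_prime_pairs_le,
    hlog.eventually (tendsto_mul_prime_pairs_bound.eventually_le_const
      (show (0 : ℝ) < ε / 2 by linarith)), eventually_half_le_primeCounting'_mul_log,
    eventually_ge_atTop 3]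
    with x h1 h2 h3 h4 d hd hdx
  refine (h1 x d rfl hd hdx).trans ?_
  set b := Real.exp 24 * (5 * Real.log (Real.log x)) ^ 16 / (Real.log x ^ (3 / 4 : ℝ)) ^ 2
      + (Real.log x ^ 26)⁻¹ * (Real.exp 24 * (3 * Real.log x) ^ 24)
      + 2 * Real.exp (-(Real.log x / 2)) with hb
  have hx3 : (3 : ℝ) ≤ x := by exact_mod_cast h4
  have hl : 0 < Real.log x := Real.log_pos (by linarith)
  have hb0 : 0 ≤ b := by rw [hb]; positivity
  calc (x : ℝ) * b ≤ (2 * (Nat.primeCounting' x * Real.log x)) * b := by gcongr; linarith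
    _ = 2 * Nat.primeCounting' x * (Real.log x * b) := by ring
    _ ≤ 2 * Nat.primeCounting' x * (ε / 2) := by gcongr
    _ = _ := by ring

theorem card_prime_indices_add_eq_le (N d : ℕ) :
    ((Finset.range N ×ˢ Finset.range N).filter
      (fun q => Nat.nth Nat.Prime q.1 = Nat.nth Nat.Prime q.2 + d)).card ≤
      ((Finset.range (Nat.nth Nat.Prime N)).filter (fun n => n.Prime ∧ (n + d).Prime)).card := by
  have hmono : StrictMono (Nat.nth Nat.Prime) := Nat.nth_strictMono Nat.infinite_setOfPred_prime
  refine Finset.card_le_card_of_injOn (fun q => Nat.nth Nat.Prime q.2) ?_ ?_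
  · intro q hq
    simp only [Finset.coe_filter, Finset.mem_product, Finset.mem_range, Set.mem_ofPred_eq] at hq ⊢
    refine ⟨hmono hq.1.2, Nat.prime_nth_prime _, ?_⟩
    rw [← hq.2]
    exact Nat.prime_nth_prime _
  · rintro ⟨i, j⟩ hq ⟨i', j'⟩ hq' h
    simp only [Finset.coe_filter, Finset.mem_product, Finset.mem_range, Set.mem_ofPred_eq]
      at hq hq' h
    have h2 : Nat.nth Nat.Prime i = Nat.nth Nat.Prime i' := by omega
    rw [hmono.injective h, hmono.injective h2]

theorem eventually_card_prime_indices_sub_eq_le {ε : ℝ} (hε : 0 < ε) :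
    ∀ᶠ N : ℕ in atTop, ∀ D : ℤ, D ≠ 0 →
      (((Finset.range N ×ˢ Finset.range N).filter
        (fun q => (Nat.nth Nat.Prime q.1 : ℤ) - Nat.nth Nat.Prime q.2 = D)).card : ℝ) ≤ ε * N := by
  have hmono : StrictMono (Nat.nth Nat.Prime) := Nat.nth_strictMono Nat.infinite_setOfPred_prime
  filter_upwards [hmono.tendsto_atTop.eventually
    (eventually_card_prime_pairs_le_mul_primeCounting' hε)] with N hN D hD
  rw [Nat.primeCounting'_nth_eq] at hN
  have hpos : ∀ d : ℕ, d ≠ 0 → (((Finset.range N ×ˢ Finset.range N).filter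
      (fun q => Nat.nth Nat.Prime q.1 = Nat.nth Nat.Prime q.2 + d)).card : ℝ) ≤ ε * N := by
    intro d hd
    by_cases hdx : d ≤ Nat.nth Nat.Prime N
    · exact (Nat.cast_le.2 (card_prime_indices_add_eq_le N d)).trans (hN d hd hdx)
    · rw [Finset.filter_false_of_mem, Finset.card_empty, Nat.cast_zero]
      · positivity
      · intro q hq h
        rw [Finset.mem_product, Finset.mem_range] at hq
        have := hmono hq.1
        omega
  rcases le_or_gt 0 D with h | h
  · convert hpos D.natAbs (by omega) using 5 with q
    omega
  · refine le_of_eq_of_le ?_ (hpos D.natAbs (by omega))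
    congr 1
    refine Finset.card_bij (fun q _ => (q.2, q.1)) ?_ ?_ ?_
    · intro q hq
      simp only [Finset.mem_filter, Finset.mem_product] at hq ⊢
      exact ⟨⟨hq.1.2, hq.1.1⟩, by omega⟩
    · rintro ⟨i, j⟩ _ ⟨i', j'⟩ _ h
      simp only [Prod.mk.injEq] at h ⊢
      exact ⟨h.2, h.1⟩
    · intro q hq
      simp only [Finset.mem_filter, Finset.mem_product] at hq
      refine ⟨(q.2, q.1), ?_, rfl⟩
      simp only [Finset.mem_filter, Finset.mem_product]
      exact ⟨⟨hq.1.2, hq.1.1⟩, by omega⟩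

/-- The pairs of off-diagonal index pairs in `[N]` with equal differences `a i - a j`. -/
def equalDiffPairs (a : ℕ → ℕ) (N : ℕ) : Finset ((ℕ × ℕ) × (ℕ × ℕ)) :=
  ((Finset.range N).offDiag ×ˢ (Finset.range N).offDiag).filter
    (fun q => (a q.1.1 : ℤ) - a q.1.2 = a q.2.1 - a q.2.2)

/-- The additive energy of the first `N` primes is `o(N ^ 3)`. -/
theorem eventually_card_equalDiffPairs_primes_le {ε : ℝ} (hε : 0 < ε) :
    ∀ᶠ N : ℕ in atTop, ((equalDiffPairs (Nat.nth Nat.Prime) N).card : ℝ) ≤ ε * N ^ 3 := by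
  have hmono : StrictMono (Nat.nth Nat.Prime) := Nat.nth_strictMono Nat.infinite_setOfPred_prime
  filter_upwards [eventually_card_prime_indices_sub_eq_le hε] with N hN
  rw [equalDiffPairs, Finset.card_filter, Finset.sum_product, Nat.cast_sum]
  have h1 : ∀ q ∈ (Finset.range N).offDiag, ((∑ r ∈ (Finset.range N).offDiag,
      if (Nat.nth Nat.Prime q.1 : ℤ) - Nat.nth Nat.Prime q.2
        = Nat.nth Nat.Prime r.1 - Nat.nth Nat.Prime r.2 then 1 else 0 : ℕ) : ℝ) ≤ ε * N := by
    intro q hq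
    rw [← Finset.card_filter]
    have hne : (Nat.nth Nat.Prime q.1 : ℤ) - Nat.nth Nat.Prime q.2 ≠ 0 := by
      have := hmono.injective.ne (Finset.mem_offDiag.1 hq).2.2
      omega
    refine le_trans ?_ (hN _ hne)
    gcongr
    intro r hr
    rw [Finset.mem_filter] at hr ⊢
    exact ⟨Finset.mem_product.2 ⟨(Finset.mem_offDiag.1 hr.1).1, (Finset.mem_offDiag.1 hr.1).2.1⟩,
      hr.2.symm⟩
  refine (Finset.sum_le_sum h1).trans ?_
  rw [Finset.sum_const, nsmul_eq_mul, Finset.offDiag_card, Finset.card_range]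
  have : ((N * N - N : ℕ) : ℝ) ≤ N * N := by exact_mod_cast Nat.sub_le _ _
  calc ((N * N - N : ℕ) : ℝ) * (ε * N) ≤ (N * N) * (ε * N) := by gcongr
    _ = _ := by ring

theorem measurePreserving_zsmul_sub (D : ℤ) :
    MeasurePreserving (fun p : UnitAddCircle × UnitAddCircle => D • p.1 - p.2)
      (volume.prod volume) volume := by
  have : IsProbabilityMeasure (volume : Measure UnitAddCircle) := ⟨UnitAddCircle.measure_univ⟩
  refine measurePreserving_snd.comp (MeasurePreserving.skew_product (μb := volume)
    (f := id) (g := fun a c : UnitAddCircle => D • a - c) (MeasurePreserving.id _) ?_ ?_)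
  · exact (by fun_prop :
      Continuous fun p : UnitAddCircle × UnitAddCircle => D • p.1 - p.2).measurable
  · exact ae_of_all _ fun a => (Measure.measurePreserving_sub_left volume (D • a)).map_eq

theorem measurePreserving_zsmul_sub_prodMk {D D' : ℤ} (h : D ≠ D') :
    MeasurePreserving
      (fun p : UnitAddCircle × UnitAddCircle => (D • p.1 - p.2, D' • p.1 - p.2))
      (volume.prod volume) (volume.prod volume) := by
  have : IsProbabilityMeasure (volume : Measure UnitAddCircle) := ⟨UnitAddCircle.measure_univ⟩
  have h1 : MeasurePreserving (fun p : UnitAddCircle × UnitAddCircle => (p.1, D • p.1 - p.2))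
      (volume.prod volume) (volume.prod volume) := by
    refine MeasurePreserving.skew_product (f := id)
      (g := fun a c : UnitAddCircle => D • a - c) (MeasurePreserving.id _) ?_ ?_
    · exact (by fun_prop :
        Continuous fun p : UnitAddCircle × UnitAddCircle => D • p.1 - p.2).measurable
    · exact ae_of_all _ fun a => (Measure.measurePreserving_sub_left volume (D • a)).map_eq
  have h2 : MeasurePreserving
      (fun p : UnitAddCircle × UnitAddCircle => (p.1, (D' - D) • p.2 + p.1))
      (volume.prod volume) (volume.prod volume) := by
    refine MeasurePreserving.skew_product (f := id)
      (g := fun u a : UnitAddCircle => (D' - D) • a + u) (MeasurePreserving.id _) ?_ ?_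
    · exact (by fun_prop :
        Continuous fun p : UnitAddCircle × UnitAddCircle => (D' - D) • p.2 + p.1).measurable
    · refine ae_of_all _ fun u => ?_
      exact ((measurePreserving_add_right volume u).comp
        (Measure.measurePreserving_zsmul volume (sub_ne_zero.2 h.symm))).map_eq
  convert (h2.comp Measure.measurePreserving_swap).comp h1 using 2 with p
  simp only [Function.comp_apply, Prod.swap_prod_mk, Prod.mk.injEq, true_and, sub_zsmul]
  abel

/-- The second moment of the deviation of a sum of indicators from its mean only sees the pairs
that are not independent. -/
theorem integral_sum_indicator_sub_sq_le {Ω ι : Type*} [MeasurableSpace Ω] (μ : Measure Ω)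
    [IsProbabilityMeasure μ] (I : Finset ι) (S : ι → Set Ω) (hS : ∀ i, MeasurableSet (S i))
    (b : ℝ) (hb₀ : 0 ≤ b) (hb : ∀ i, μ.real (S i) = b) (R : Finset (ι × ι))
    (hR : ∀ i ∈ I, ∀ j ∈ I, (i, j) ∉ R → μ.real (S i ∩ S j) = b * b) :
    ∫ x, (∑ i ∈ I, (S i).indicator (fun _ => (1 : ℝ)) x - I.card * b) ^ 2 ∂μ ≤ R.card * b := by
  classical
  have hi : ∀ i, Integrable ((S i).indicator (fun _ => (1 : ℝ))) μ := fun i =>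
    (integrable_const _).indicator (hS i)
  have hij : ∀ i j, Integrable ((S i ∩ S j).indicator (fun _ => (1 : ℝ))) μ := fun i j =>
    (integrable_const _).indicator ((hS i).inter (hS j))
  have hInt : ∀ T : Set Ω, MeasurableSet T →
      ∫ x, T.indicator (fun _ => (1 : ℝ)) x ∂μ = μ.real T := fun T hT =>
    integral_indicator_one hT
  have hsq : ∀ x, (∑ i ∈ I, (S i).indicator (fun _ => (1 : ℝ)) x - I.card * b) ^ 2 =
      ∑ p ∈ I ×ˢ I, ((S p.1 ∩ S p.2).indicator (fun _ => (1 : ℝ)) x -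
        b * (S p.1).indicator (fun _ => (1 : ℝ)) x - b * (S p.2).indicator (fun _ => (1 : ℝ)) x
        + b * b) := by
    intro x
    have : ∑ i ∈ I, (S i).indicator (fun _ => (1 : ℝ)) x - I.card * b =
        ∑ i ∈ I, ((S i).indicator (fun _ => (1 : ℝ)) x - b) := by simp
    rw [this, sq, Finset.sum_mul_sum, ← Finset.sum_product']
    refine Finset.sum_congr rfl fun p _ => ?_
    by_cases h1 : x ∈ S p.1 <;> by_cases h2 : x ∈ S p.2 <;> simp [h1, h2] <;> ring
  have hterm : ∀ p : ι × ι, Integrable (fun x => (S p.1 ∩ S p.2).indicator (fun _ => (1 : ℝ)) x -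
        b * (S p.1).indicator (fun _ => (1 : ℝ)) x - b * (S p.2).indicator (fun _ => (1 : ℝ)) x
        + b * b) μ := fun p =>
    (((hij _ _).sub ((hi _).const_mul b)).sub ((hi _).const_mul b)).add (integrable_const _)
  simp_rw [hsq]
  rw [integral_finsetSum _ fun p _ => hterm p]
  have hval : ∀ p : ι × ι, ∫ x, ((S p.1 ∩ S p.2).indicator (fun _ => (1 : ℝ)) x -
        b * (S p.1).indicator (fun _ => (1 : ℝ)) x - b * (S p.2).indicator (fun _ => (1 : ℝ)) x
        + b * b) ∂μ = μ.real (S p.1 ∩ S p.2) - b * b := by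
    intro p
    have e₁ : Integrable (fun x => b * (S p.1).indicator (fun _ => (1 : ℝ)) x) μ :=
      (hi _).const_mul b
    have e₂ : Integrable (fun x => b * (S p.2).indicator (fun _ => (1 : ℝ)) x) μ :=
      (hi _).const_mul b
    have e₃ : Integrable (fun x => (S p.1 ∩ S p.2).indicator (fun _ => (1 : ℝ)) x -
        b * (S p.1).indicator (fun _ => (1 : ℝ)) x) μ := (hij _ _).sub e₁
    have e₄ : Integrable (fun x => (S p.1 ∩ S p.2).indicator (fun _ => (1 : ℝ)) x -
        b * (S p.1).indicator (fun _ => (1 : ℝ)) x -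
        b * (S p.2).indicator (fun _ => (1 : ℝ)) x) μ := e₃.sub e₂
    rw [integral_add e₄ (integrable_const _), integral_sub e₃ e₂, integral_sub (hij _ _) e₁,
      integral_const_mul, integral_const_mul, hInt _ (hS _), hInt _ (hS _),
      hInt _ ((hS _).inter (hS _)), hb, hb]
    simp
  simp_rw [hval]
  have hzero : ∀ p ∈ I ×ˢ I, μ.real (S p.1 ∩ S p.2) - b * b ≤ if p ∈ R then b else 0 := by
    intro p hp
    rw [Finset.mem_product] at hp
    split_ifs with h
    · have : μ.real (S p.1 ∩ S p.2) ≤ b := hb p.1 ▸ measureReal_mono inter_subset_left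
      nlinarith [mul_self_nonneg b]
    · rw [hR p.1 hp.1 p.2 hp.2 h, sub_self]
  refine (Finset.sum_le_sum hzero).trans ?_
  rw [← Finset.sum_filter, Finset.sum_const, nsmul_eq_mul]
  refine mul_le_mul_of_nonneg_right ?_ hb₀
  exact_mod_cast Finset.card_le_card fun p hp => (Finset.mem_filter.1 hp).2

theorem ae_tendsto_zero_of_integral_sq_le {Ω : Type*} [MeasurableSpace Ω] {μ : Measure Ω}
    {f : ℕ → Ω → ℝ} (hf : ∀ t, Measurable (f t)) (hf₂ : ∀ t, Integrable (fun x => f t x ^ 2) μ)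
    {u : ℕ → ℝ} (hu : Summable u) (h : ∀ t, ∫ x, f t x ^ 2 ∂μ ≤ u t) :
    ∀ᵐ x ∂μ, Tendsto (fun t => f t x) atTop (nhds 0) := by
  have hmeas : ∀ t, Measurable fun x => ENNReal.ofReal (f t x ^ 2) := fun t =>
    ((hf t).pow_const 2).ennreal_ofReal
  have hfin : ∫⁻ x, ∑' t, ENNReal.ofReal (f t x ^ 2) ∂μ ≠ ⊤ := by
    rw [lintegral_tsum fun t => (hmeas t).aemeasurable]
    refine ne_top_of_le_ne_top hu.tsum_ofReal_ne_top (ENNReal.tsum_le_tsum fun t => ?_)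
    rw [← ofReal_integral_eq_lintegral_ofReal (hf₂ t) (ae_of_all _ fun x => sq_nonneg _)]
    exact ENNReal.ofReal_le_ofReal (h t)
  filter_upwards [ae_lt_top (Measurable.tsum hmeas) hfin] with x hx
  have h0 := ENNReal.tendsto_atTop_zero_of_tsum_ne_top hx.ne
  have h1 : Tendsto (fun t => f t x ^ 2) atTop (nhds 0) := by
    have := (ENNReal.tendsto_toReal ENNReal.zero_ne_top).comp h0
    simpa [Function.comp_def, ENNReal.toReal_ofReal (sq_nonneg _)] using this
  have h2 := h1.sqrt
  simp only [Real.sqrt_sq_eq_abs, Real.sqrt_zero] at h2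
  exact (tendsto_zero_iff_abs_tendsto_zero _).2 h2

/-- The set of `(α, γ)` for which `a_i α - a_j α` lies within `ε` of `γ`. -/
def pairEvent (a : ℕ → ℕ) (ε : ℝ) (ij : ℕ × ℕ) : Set (𝕋 × 𝕋) :=
  (fun p : 𝕋 × 𝕋 => ((a ij.1 : ℤ) - a ij.2) • p.1 - p.2) ⁻¹' Metric.closedBall 0 ε

theorem measurableSet_pairEvent (a : ℕ → ℕ) (ε : ℝ) (ij : ℕ × ℕ) :
    MeasurableSet (pairEvent a ε ij) :=
  (measurePreserving_zsmul_sub _).measurable measurableSet_closedBall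

theorem volume_real_pairEvent (a : ℕ → ℕ) (ε : ℝ) (ij : ℕ × ℕ) :
    volume.real (pairEvent a ε ij) = volume.real (Metric.closedBall (0 : 𝕋) ε) :=
  (measurePreserving_zsmul_sub _).measureReal_preimage measurableSet_closedBall.nullMeasurableSet

theorem volume_real_pairEvent_inter (a : ℕ → ℕ) (ε : ℝ) {ij kl : ℕ × ℕ}
    (h : (a ij.1 : ℤ) - a ij.2 ≠ a kl.1 - a kl.2) :
    volume.real (pairEvent a ε ij ∩ pairEvent a ε kl) =
      volume.real (Metric.closedBall (0 : 𝕋) ε) * volume.real (Metric.closedBall (0 : 𝕋) ε) := by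
  rw [← measureReal_prod_prod]
  exact (measurePreserving_zsmul_sub_prodMk h).measureReal_preimage
    (measurableSet_closedBall.prod measurableSet_closedBall).nullMeasurableSet

theorem Fpc_eq_sum_indicator (A : Set ℕ) (N : ℕ) (s : ℝ) (p : 𝕋 × 𝕋) :
    Fpc p.1 p.2 s N A = (∑ ij ∈ (Finset.range N).offDiag,
      (pairEvent (enum A) (s / N) ij).indicator (fun _ => (1 : ℝ)) p) / N := by
  classical
  unfold Fpc Fseq
  congr 1
  simp only [Set.indicator_apply]
  rw [Finset.sum_boole, ← Set.ncard_coe_finset]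
  congr 2
  ext ij
  have e : ((enum A ij.1 : ℤ) - enum A ij.2) • p.1 =
      enum A ij.1 • p.1 - enum A ij.2 • p.1 := by simp only [sub_zsmul, natCast_zsmul]; abel
  simp [pairEvent, e, and_assoc]

theorem Fpc_mono (A : Set ℕ) (N : ℕ) (α γ : 𝕋) {s s' : ℝ} (h : s ≤ s') :
    Fpc α γ s N A ≤ Fpc α γ s' N A := by
  rw [Fpc_eq_sum_indicator A N s (α, γ), Fpc_eq_sum_indicator A N s' (α, γ)]
  gcongr with ij _
  exact preimage_mono (Metric.closedBall_subset_closedBall (by gcongr))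

theorem measurable_Fpc (A : Set ℕ) (N : ℕ) (s : ℝ) :
    Measurable fun p : 𝕋 × 𝕋 => Fpc p.1 p.2 s N A := by
  simp_rw [Fpc_eq_sum_indicator]
  exact (Finset.measurable_fun_sum _ fun ij _ =>
    measurable_const.indicator (measurableSet_pairEvent _ _ ij)).div_const _

theorem abs_Fpc_le (A : Set ℕ) (N : ℕ) (s : ℝ) (p : 𝕋 × 𝕋) :
    |Fpc p.1 p.2 s N A| ≤ (Finset.range N).offDiag.card / N := by
  rw [Fpc_eq_sum_indicator, abs_div, Nat.abs_cast]
  gcongr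
  refine (Finset.abs_sum_le_sum_abs _ _).trans ?_
  refine (Finset.sum_le_card_nsmul _ _ 1 fun ij _ => ?_).trans (by simp)
  by_cases h : p ∈ pairEvent (enum A) (s / N) ij <;> simp [h]

theorem volume_real_closedBall_unitAddCircle {ε : ℝ} (hε : 0 ≤ ε) :
    volume.real (Metric.closedBall (0 : 𝕋) ε) = min 1 (2 * ε) := by
  rw [measureReal_def, AddCircle.volume_closedBall, ENNReal.toReal_ofReal (by positivity)]

/-- The second moment of the pair correlation function about its mean. -/
theorem integral_Fpc_sub_sq_le (A : Set ℕ) {N : ℕ} (hN : 0 < N) {s : ℝ} (hs : 0 ≤ s) :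
    ∫ p : 𝕋 × 𝕋, (Fpc p.1 p.2 s N A - (N - 1) * min 1 (2 * (s / N))) ^ 2 ≤
      2 * s * ((equalDiffPairs (enum A) N).card / N ^ 3) := by
  have : IsProbabilityMeasure (volume : Measure 𝕋) := ⟨UnitAddCircle.measure_univ⟩
  have hN' : (0 : ℝ) < N := by exact_mod_cast hN
  set b : ℝ := min 1 (2 * (s / N)) with hb
  have hb₀ : 0 ≤ b := by positivity
  have hcard : ((Finset.range N).offDiag.card : ℝ) = N * (N - 1) := by
    rw [Finset.offDiag_card, Finset.card_range, Nat.cast_sub (Nat.le_mul_self N)]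
    push_cast
    ring
  have hvol := volume_real_closedBall_unitAddCircle (ε := s / N) (by positivity)
  have key := integral_sum_indicator_sub_sq_le (volume : Measure (𝕋 × 𝕋))
    (Finset.range N).offDiag (pairEvent (enum A) (s / N))
    (measurableSet_pairEvent (enum A) (s / N)) b hb₀
    (fun ij => (volume_real_pairEvent _ _ ij).trans hvol) (equalDiffPairs (enum A) N)
    (fun ij hij kl hkl h => by
      rw [volume_real_pairEvent_inter _ _ fun e => h ?_, hvol]
      exact Finset.mem_filter.2 ⟨Finset.mem_product.2 ⟨hij, hkl⟩, e⟩)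
  have hF : ∀ p : 𝕋 × 𝕋, (Fpc p.1 p.2 s N A - (N - 1) * b) ^ 2 =
      (∑ ij ∈ (Finset.range N).offDiag,
        (pairEvent (enum A) (s / N) ij).indicator (fun _ => (1 : ℝ)) p -
          (Finset.range N).offDiag.card * b) ^ 2 / N ^ 2 := fun p => by
    rw [Fpc_eq_sum_indicator, hcard, ← div_pow]
    congr 1
    field_simp
  simp_rw [hF]
  rw [integral_div]
  calc _ ≤ (equalDiffPairs (enum A) N).card * b / N ^ 2 := by gcongr
    _ ≤ (equalDiffPairs (enum A) N).card * (2 * (s / N)) / N ^ 2 := by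
      gcongr
      exact min_le_right _ _
    _ = _ := by field_simp

theorem tendsto_mean_Fpc {M : ℕ → ℕ} (hM : Tendsto M atTop atTop) (s : ℝ) :
    Tendsto (fun t => ((M t : ℝ) - 1) * min 1 (2 * (s / M t))) atTop (nhds (2 * s)) := by
  have hM' : Tendsto (fun t => (M t : ℝ)) atTop atTop := tendsto_natCast_atTop_atTop.comp hM
  have h1 : Tendsto (fun t => 2 * s - 2 * (s / M t)) atTop (nhds (2 * s)) := by
    simpa using (tendsto_const_nhds (x := 2 * s)).sub
      ((hM'.const_div_atTop s).const_mul 2)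
  refine h1.congr' ?_
  filter_upwards [hM'.eventually_ge_atTop (2 * s), hM'.eventually_gt_atTop 0] with t ht ht₀
  rw [min_eq_right]
  · field_simp
  · rw [← mul_div_assoc, div_le_one ht₀]
    exact ht

theorem ae_tendsto_Fpc (A : Set ℕ) {M : ℕ → ℕ} (hM : Tendsto M atTop atTop)
    (hM₀ : ∀ t, 0 < M t) {u : ℕ → ℝ} (hu : Summable u)
    (h : ∀ t, ((equalDiffPairs (enum A) (M t)).card : ℝ) ≤ u t * M t ^ 3) {s : ℝ} (hs : 0 ≤ s) :
    ∀ᵐ p : 𝕋 × 𝕋, Tendsto (fun t => Fpc p.1 p.2 s (M t) A) atTop (nhds (2 * s)) := by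
  have : IsProbabilityMeasure (volume : Measure 𝕋) := ⟨UnitAddCircle.measure_univ⟩
  have hmeas : ∀ t, Measurable fun p : 𝕋 × 𝕋 =>
      Fpc p.1 p.2 s (M t) A - ((M t : ℝ) - 1) * min 1 (2 * (s / M t)) := fun t =>
    (measurable_Fpc A (M t) s).sub_const _
  have hInt : ∀ t, Integrable (fun p : 𝕋 × 𝕋 =>
      (Fpc p.1 p.2 s (M t) A - ((M t : ℝ) - 1) * min 1 (2 * (s / M t))) ^ 2) := by
    intro t
    refine Integrable.of_bound ((hmeas t).pow_const 2).aestronglyMeasurable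
      (((Finset.range (M t)).offDiag.card / M t +
        |((M t : ℝ) - 1) * min 1 (2 * (s / M t))|) ^ 2) (ae_of_all _ fun p => ?_)
    rw [norm_pow, Real.norm_eq_abs]
    gcongr
    exact (abs_sub _ _).trans (by gcongr; exact abs_Fpc_le A (M t) s p)
  have hle : ∀ t, ∫ p : 𝕋 × 𝕋,
      (Fpc p.1 p.2 s (M t) A - ((M t : ℝ) - 1) * min 1 (2 * (s / M t))) ^ 2 ≤
        2 * s * u t := by
    intro t
    have hMt : (0 : ℝ) < M t := by exact_mod_cast hM₀ t
    refine (integral_Fpc_sub_sq_le A (hM₀ t) hs).trans ?_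
    gcongr
    rw [div_le_iff₀ (by positivity)]
    exact h t
  filter_upwards [ae_tendsto_zero_of_integral_sq_le hmeas hInt (hu.mul_left (2 * s)) hle]
    with p hp
  simpa using hp.add (tendsto_mean_Fpc hM s)

theorem tendsto_Fpc_of_forall_rat {A : Set ℕ} {M : ℕ → ℕ} {α γ : 𝕋}
    (h : ∀ q : ℚ, 0 < q → Tendsto (fun t => Fpc α γ q (M t) A) atTop (nhds (2 * q)))
    {s : ℝ} (hs : 0 < s) :
    Tendsto (fun t => Fpc α γ s (M t) A) atTop (nhds (2 * s)) := by
  refine tendsto_order.2 ⟨fun c hc => ?_, fun c hc => ?_⟩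
  · obtain ⟨q, hq₁, hq₂⟩ := exists_rat_btwn (max_lt hs (by linarith : c / 2 < s))
    have hq₀ : (0 : ℚ) < q := by exact_mod_cast (le_max_left _ _).trans_lt hq₁
    have hcq : c / 2 < q := (le_max_right _ _).trans_lt hq₁
    filter_upwards [(h q hq₀).eventually_const_lt (by linarith : c < 2 * (q : ℝ))] with t ht
    exact ht.trans_le (Fpc_mono A (M t) α γ hq₂.le)
  · obtain ⟨q, hq₁, hq₂⟩ := exists_rat_btwn (by linarith : s < c / 2)
    have hq₀ : (0 : ℚ) < q := by exact_mod_cast hs.trans hq₁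
    filter_upwards [(h q hq₀).eventually_lt_const (by linarith : 2 * (q : ℝ) < c)] with t ht
    exact (Fpc_mono A (M t) α γ hq₁.le).trans_lt ht

theorem DMPPCAlong_of_card_equalDiffPairs_le (A : Set ℕ) {M : ℕ → ℕ} (hM : Tendsto M atTop atTop)
    (hM₀ : ∀ t, 0 < M t) {u : ℕ → ℝ} (hu : Summable u)
    (h : ∀ t, ((equalDiffPairs (enum A) (M t)).card : ℝ) ≤ u t * M t ^ 3) :
    DMPPCAlong A M := by
  have hq : ∀ᵐ p : 𝕋 × 𝕋, ∀ q : ℚ, 0 < q →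
      Tendsto (fun t => Fpc p.1 p.2 q (M t) A) atTop (nhds (2 * (q : ℝ))) := by
    refine ae_all_iff.2 fun q => ?_
    by_cases hq : 0 < q
    · filter_upwards [ae_tendsto_Fpc A hM hM₀ hu h (s := q) (by exact_mod_cast hq.le)] with p hp
      exact fun _ => hp
    · exact ae_of_all _ fun p h0 => absurd h0 hq
  filter_upwards [hq] with p hp s hs
  exact tendsto_Fpc_of_forall_rat hp hs

/-- **Corollary (primes).** Every strictly increasing sequence `(N_t)` of naturals has a
subsequence along which the set of primes has doubly metric Poissonian pair correlations. -/
theorem stmt_3 (Nt : ℕ → ℕ) (hNt : StrictMono Nt) :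
    ∃ φ : ℕ → ℕ, StrictMono φ ∧ DMPPCAlong {n : ℕ | n.Prime} (Nt ∘ φ) := by
  have hev : ∀ t : ℕ, ∀ᶠ k in atTop, 0 < Nt k ∧
      ((equalDiffPairs (enum {n : ℕ | n.Prime}) (Nt k)).card : ℝ) ≤
        (1 / 2 : ℝ) ^ t * Nt k ^ 3 := fun t =>
    (hNt.tendsto_atTop.eventually_gt_atTop 0).and (hNt.tendsto_atTop.eventually
      (eventually_card_equalDiffPairs_primes_le (by positivity)))
  obtain ⟨φ, hφ, h⟩ := extraction_forall_of_eventually hev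
  exact ⟨φ, hφ, DMPPCAlong_of_card_equalDiffPairs_le _
    (hNt.tendsto_atTop.comp hφ.tendsto_atTop) (fun t => (h t).1) summable_geometric_two
    fun t => (h t).2⟩
end
end

section
/- For every sequence (ε_d)_{d∈ℤ} of positive real numbers, the random variables (1_{d, ε_d})_{d∈ℤ} on T² are pairwise independent: for all distinct d₁, d₂ ∈ ℤ and all ε₁, ε₂ > 0, one has ∫_{T²} 1_{d₁,ε₁}·1_{d₂,ε₂} d Leb = (∫_{T²} 1_{d₁,ε₁} d Leb)·(∫_{T²} 1_{d₂,ε₂} d Leb). -/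
open MeasureTheory Filter Set

noncomputable section

/-- `1_{d,ε}`: the indicator function of `{(α, γ) ∈ 𝕋² : ‖dα − γ‖ ≤ ε}`. -/
noncomputable def ind (d : ℤ) (ε : ℝ) : 𝕋 × 𝕋 → ℝ :=
  Set.indicator {p : 𝕋 × 𝕋 | ‖d • p.1 - p.2‖ ≤ ε} 1

/-- For distinct `d₁, d₂`, the map `(α, γ) ↦ (d₁ α - γ, d₂ α - γ)` preserves Lebesgue measure. -/
theorem measurePreserving_zsmul_sub_pair {d₁ d₂ : ℤ} (hne : d₁ ≠ d₂) :
    MeasurePreserving (fun p : 𝕋 × 𝕋 => (d₁ • p.1 - p.2, d₂ • p.1 - p.2)) volume volume := by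
  have h₁ : MeasurePreserving (fun p : 𝕋 × 𝕋 => (p.1, d₁ • p.1 - p.2))
      (volume.prod volume) (volume.prod volume) :=
    MeasurePreserving.skew_product (g := fun x y => d₁ • x - y) (MeasurePreserving.id _)
      (by unfold Function.uncurry; fun_prop)
      (.of_forall fun x => (Measure.measurePreserving_sub_left volume (d₁ • x)).map_eq)
  have h₂ : MeasurePreserving (fun p : 𝕋 × 𝕋 => (p.1, (d₂ - d₁) • p.2 + p.1))
      (volume.prod volume) (volume.prod volume) :=
    MeasurePreserving.skew_product (g := fun x y => (d₂ - d₁) • y + x) (MeasurePreserving.id _)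
      (by unfold Function.uncurry; fun_prop)
      (.of_forall fun x => ((measurePreserving_add_right volume x).comp
        (Measure.measurePreserving_zsmul volume (sub_ne_zero.mpr hne.symm))).map_eq)
  have h := h₂.comp (Measure.measurePreserving_swap.comp h₁)
  have heq : (fun p : 𝕋 × 𝕋 => (p.1, (d₂ - d₁) • p.2 + p.1)) ∘
      Prod.swap ∘ (fun p : 𝕋 × 𝕋 => (p.1, d₁ • p.1 - p.2)) =
      fun p => (d₁ • p.1 - p.2, d₂ • p.1 - p.2) := by
    funext p
    simp only [Function.comp_apply, Prod.swap_prod_mk, sub_smul]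
    congr 1
    abel
  rw [heq] at h
  exact h

/-- **Lemma (pairwise independence).** For any sequence `(ε_d)_{d ∈ ℤ}` of positive reals, the
random variables `(1_{d, ε_d})_{d ∈ ℤ}` on `𝕋²` are pairwise independent: for distinct
`d₁, d₂ ∈ ℤ` and any `ε₁, ε₂ > 0`,
`∫ 1_{d₁,ε₁}·1_{d₂,ε₂} = (∫ 1_{d₁,ε₁})·(∫ 1_{d₂,ε₂})`. -/
theorem stmt_7 (d₁ d₂ : ℤ) (hne : d₁ ≠ d₂) (ε₁ ε₂ : ℝ) (hε₁ : 0 < ε₁) (hε₂ : 0 < ε₂) :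
    ∫ p : 𝕋 × 𝕋, ind d₁ ε₁ p * ind d₂ ε₂ p =
      (∫ p : 𝕋 × 𝕋, ind d₁ ε₁ p) * ∫ p : 𝕋 × 𝕋, ind d₂ ε₂ p := by
  set f : ℝ → 𝕋 → ℝ := fun ε => Set.indicator {x | ‖x‖ ≤ ε} 1
  have hfm (ε : ℝ) : Measurable (f ε) :=
    measurable_one.indicator (measurableSet_le measurable_norm measurable_const)
  have : IsProbabilityMeasure (volume : Measure 𝕋) := ⟨UnitAddCircle.measure_univ⟩
  have hΦ := measurePreserving_zsmul_sub_pair hne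
  have h₁ : ∫ p : 𝕋 × 𝕋, ind d₁ ε₁ p = ∫ x, f ε₁ x := by
    have h :=
      (measurePreserving_fst (μ := (volume : Measure 𝕋)) (ν := (volume : Measure 𝕋))).comp hΦ
    rw [← h.map_eq, integral_map h.measurable.aemeasurable (hfm ε₁).aestronglyMeasurable]
    rfl
  have h₂ : ∫ p : 𝕋 × 𝕋, ind d₂ ε₂ p = ∫ x, f ε₂ x := by
    have h :=
      (measurePreserving_snd (μ := (volume : Measure 𝕋)) (ν := (volume : Measure 𝕋))).comp hΦ
    rw [← h.map_eq, integral_map h.measurable.aemeasurable (hfm ε₂).aestronglyMeasurable]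
    rfl
  have hfg : Measurable fun p : 𝕋 × 𝕋 => f ε₁ p.1 * f ε₂ p.2 :=
    ((hfm ε₁).comp measurable_fst).mul ((hfm ε₂).comp measurable_snd)
  rw [h₁, h₂, ← integral_prod_mul, ← Measure.volume_eq_prod]
  conv_rhs => rw [← hΦ.map_eq]
  rw [integral_map hΦ.measurable.aemeasurable hfg.aestronglyMeasurable]
  rfl
end
end

section
/- For any sequence (Q_N)_{N∈ℕ} of Lebesgue-measurable subsets of T, there exists a sequence of positive integers (Δ_N)_{N∈ℕ} such that the sets R_N = {α ∈ T : Δ_N·α ∈ Q_N} are pairwise quasi-independent; in fact one can achieve Leb(R_M ∩ R_N) ≤ 2·Leb(R_M)·Leb(R_N) for all M ≠ N. -/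
open MeasureTheory Filter Set

noncomputable section

/-- The integral of a non-trivial character over a set invariant under translation by `u` vanishes
as soon as the character is non-trivial at `u`. -/
lemma setIntegral_fourier_eq_zero {k : ℤ} {u : 𝕋} {S : Set 𝕋} (hS : MeasurableSet S)
    (hu : k • u ≠ 0) (hSu : ∀ x, x + u ∈ S ↔ x ∈ S) :
    ∫ x in S, fourier k x ∂(AddCircle.haarAddCircle (T := 1)) = 0 := by
  have hchar : (fourier k u : ℂ) ≠ 1 := by
    rw [fourier_apply, ← fourier_zero' (T := 1)]
    exact fun h ↦ hu (AddCircle.injective_toCircle one_ne_zero (Circle.ext h))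
  rw [← integral_indicator hS]
  have htrans := integral_add_right_eq_self (μ := AddCircle.haarAddCircle (T := 1))
    (S.indicator fun x ↦ (fourier k x : ℂ)) u
  have hmul : ∀ x : 𝕋, S.indicator (fun x ↦ (fourier k x : ℂ)) (x + u) =
      fourier k u * S.indicator (fun x ↦ (fourier k x : ℂ)) x := by
    intro x
    by_cases hx : x ∈ S
    · rw [indicator_of_mem hx, indicator_of_mem ((hSu x).2 hx)]
      simp only [fourier_apply, smul_add, AddCircle.toCircle_add, Circle.coe_mul]
      ring
    · rw [indicator_of_notMem hx, indicator_of_notMem (mt (hSu x).1 hx), mul_zero]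
  simp_rw [hmul, integral_const_mul] at htrans
  by_contra h
  exact hchar (mul_right_cancel₀ h (htrans.trans (one_mul _).symm))

/-- The Haar measure of the preimage of a set under `x ↦ n • x` is the measure of the set. -/
lemma measurePreserving_nsmul_haarAddCircle {n : ℕ} (hn : 0 < n) :
    MeasurePreserving (fun x : 𝕋 ↦ n • x) AddCircle.haarAddCircle AddCircle.haarAddCircle := by
  simpa using MeasureTheory.Measure.measurePreserving_zsmul (AddCircle.haarAddCircle (T := 1))
    (n := (n : ℤ)) (by exact_mod_cast hn.ne')

lemma tendsto_setIntegral_preimage_nsmul_fourier {B : Set 𝕋} (hB : MeasurableSet B) (k : ℤ) :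
    Tendsto (fun n : ℕ ↦ ∫ x in {x : 𝕋 | n • x ∈ B}, fourier k x
        ∂(AddCircle.haarAddCircle (T := 1))) atTop
      (nhds (AddCircle.haarAddCircle.real B •
        ∫ x, fourier k x ∂(AddCircle.haarAddCircle (T := 1)))) := by
  refine tendsto_const_nhds.congr' ?_
  filter_upwards [eventually_gt_atTop k.natAbs] with n hn
  have hn0 : 0 < n := by omega
  have hmeas : MeasurableSet {x : 𝕋 | n • x ∈ B} :=
    (measurePreserving_nsmul_haarAddCircle hn0).measurable hB
  obtain rfl | hk := eq_or_ne k 0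
  · have hvol : AddCircle.haarAddCircle.real {x : 𝕋 | n • x ∈ B} =
        AddCircle.haarAddCircle.real B :=
      congrArg ENNReal.toReal
        ((measurePreserving_nsmul_haarAddCircle hn0).measure_preimage hB.nullMeasurableSet)
    simp [hvol]
  · have hord : addOrderOf (((1 / n : ℝ) : ℝ) : 𝕋) = n := by
      simpa using AddCircle.addOrderOf_div_of_gcd_eq_one (p := (1 : ℝ)) (m := 1) hn0
        (Nat.gcd_one_left n)
    have hku : k • (((1 / n : ℝ) : ℝ) : 𝕋) ≠ 0 := by
      rw [Ne, ← addOrderOf_dvd_iff_zsmul_eq_zero, hord, Int.natCast_dvd]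
      exact fun h ↦ absurd (Nat.le_of_dvd (Int.natAbs_pos.2 hk) h) (by omega)
    have hnu : n • (((1 / n : ℝ) : ℝ) : 𝕋) = 0 := by
      rw [← addOrderOf_dvd_iff_nsmul_eq_zero, hord]
    rw [setIntegral_fourier_eq_zero hmeas hku
        (fun x ↦ by rw [mem_ofPred_eq, smul_add, hnu, add_zero]; rfl),
      ← setIntegral_univ, setIntegral_fourier_eq_zero MeasurableSet.univ hku (by simp), smul_zero]

/-- The maps `x ↦ n • x` of the circle are mixing, tested on an integrable function and a set. -/
lemma tendsto_setIntegral_preimage_nsmul {B : Set 𝕋} (hB : MeasurableSet B)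
    (f : Lp ℂ 1 (AddCircle.haarAddCircle (T := 1))) :
    Tendsto (fun n : ℕ ↦ ∫ x in {x : 𝕋 | n • x ∈ B}, f x ∂AddCircle.haarAddCircle) atTop
      (nhds (AddCircle.haarAddCircle.real B • ∫ x, f x ∂AddCircle.haarAddCircle)) := by
  let μ := AddCircle.haarAddCircle (T := 1)
  let V : Submodule ℂ (Lp ℂ 1 μ) :=
    { carrier := {f | Tendsto (fun n : ℕ ↦ ∫ x in {x : 𝕋 | n • x ∈ B}, f x ∂μ) atTop
        (nhds (μ.real B • ∫ x, f x ∂μ))}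
      zero_mem' := by
        simp
      add_mem' := by
        intro f g hf hg
        have h : ∀ s : Set 𝕋, ∫ x in s, (f + g) x ∂μ = ∫ x in s, f x ∂μ + ∫ x in s, g x ∂μ :=
          fun s ↦ by
            rw [integral_congr_ae (ae_restrict_of_ae (Lp.coeFn_add f g))]
            exact integral_add (L1.integrable_coeFn f).integrableOn
              (L1.integrable_coeFn g).integrableOn
        have h' : ∫ x, (f + g) x ∂μ = ∫ x, f x ∂μ + ∫ x, g x ∂μ := by simpa using h univ
        simp only [mem_ofPred_eq, h, h', smul_add]
        exact Tendsto.add hf hg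
      smul_mem' := by
        intro c f hf
        have h : ∀ s : Set 𝕋, ∫ x in s, (c • f) x ∂μ = c • ∫ x in s, f x ∂μ := fun s ↦ by
          rw [integral_congr_ae (ae_restrict_of_ae (Lp.coeFn_smul c f))]
          exact integral_smul c _
        have h' : ∫ x, (c • f) x ∂μ = c • ∫ x, f x ∂μ := by simpa using h univ
        simp only [mem_ofPred_eq, h, h', smul_comm _ c]
        exact Tendsto.const_smul hf c }
  have hdist : ∀ (s : Set 𝕋) (f g : Lp ℂ 1 μ),
      dist (∫ x in s, f x ∂μ) (∫ x in s, g x ∂μ) ≤ 1 * dist f g := by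
    intro s f g
    rw [dist_eq_norm, dist_eq_norm, one_mul, ← integral_sub (L1.integrable_coeFn f).integrableOn
      (L1.integrable_coeFn g).integrableOn, L1.norm_eq_integral_norm]
    calc _ ≤ ∫ x in s, ‖f x - g x‖ ∂μ := norm_integral_le_integral_norm _
      _ ≤ ∫ x, ‖f x - g x‖ ∂μ := setIntegral_le_integral
        ((L1.integrable_coeFn f).sub (L1.integrable_coeFn g)).norm
        (Eventually.of_forall fun _ ↦ norm_nonneg _)
      _ = _ := integral_congr_ae <| by
        filter_upwards [Lp.coeFn_sub f g] with x hx
        rw [hx, Pi.sub_apply]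
  have hcont : Continuous fun f : Lp ℂ 1 μ ↦ μ.real B • ∫ x, f x ∂μ :=
    (continuous_integral (μ := μ) (G := ℂ)).const_smul (μ.real B)
  have hclosed : IsClosed (V : Set (Lp ℂ 1 μ)) :=
    (LipschitzWith.uniformEquicontinuous
      (fun (n : ℕ) (f : Lp ℂ 1 μ) ↦ ∫ x in {x : 𝕋 | n • x ∈ B}, f x ∂μ) 1
      fun n ↦ LipschitzWith.of_dist_le_mul
        fun f g ↦ hdist _ f g).equicontinuous.isClosed_setOfPred_tendsto
      hcont
  have hspan : Submodule.span ℂ (range (fourierLp (T := 1) 1)) ≤ V := by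
    rw [Submodule.span_le]
    rintro _ ⟨k, rfl⟩
    have h : ∀ s : Set 𝕋, ∫ x in s, fourierLp (T := 1) 1 k x ∂μ = ∫ x in s, fourier k x ∂μ :=
      fun s ↦ integral_congr_ae (ae_restrict_of_ae (coeFn_fourierLp 1 k))
    have h' : ∫ x, fourierLp (T := 1) 1 k x ∂μ = ∫ x, fourier k x ∂μ := by simpa using h univ
    change Tendsto _ _ _
    simp only [h, h']
    exact tendsto_setIntegral_preimage_nsmul_fourier hB k
  have htop := span_fourierLp_closure_eq_top (T := 1) ENNReal.one_ne_top ▸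
    Submodule.topologicalClosure_minimal _ hspan hclosed
  exact htop Submodule.mem_top

/-- The maps `x ↦ n • x` of the circle are mixing. -/
lemma tendsto_measureReal_inter_preimage_nsmul {A B : Set 𝕋} (hA : MeasurableSet A)
    (hB : MeasurableSet B) :
    Tendsto (fun n : ℕ ↦ AddCircle.haarAddCircle.real (A ∩ {x : 𝕋 | n • x ∈ B})) atTop
      (nhds (AddCircle.haarAddCircle.real A * AddCircle.haarAddCircle.real B)) := by
  let μ := AddCircle.haarAddCircle (T := 1)
  have h := tendsto_setIntegral_preimage_nsmul hB
    (indicatorConstLp 1 hA (measure_ne_top μ A) (1 : ℂ))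
  rw [integral_indicatorConstLp] at h
  have hre := (Complex.continuous_re.tendsto _).comp h
  have hlim : (μ.real B • (μ.real A • (1 : ℂ))).re = μ.real A * μ.real B := by
    simp [mul_comm]
  rw [hlim] at hre
  refine hre.congr' ?_
  filter_upwards [eventually_gt_atTop 0] with n hn
  have hmeas : MeasurableSet {x : 𝕋 | n • x ∈ B} :=
    (measurePreserving_nsmul_haarAddCircle hn).measurable hB
  simp [setIntegral_indicatorConstLp hmeas]

/-- If, for all `M` and `d`, the relation `r M d N n` holds for all large `n`, then a sequence `Δ`
can be chosen so that `r M (Δ M) N (Δ N)` holds for all `M < N`. -/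
lemma exists_pos_seq_forall_lt {r : ℕ → ℕ → ℕ → ℕ → Prop}
    (h : ∀ M d N, 0 < d → ∀ᶠ n in atTop, r M d N n) :
    ∃ Δ : ℕ → ℕ, (∀ N, 0 < Δ N) ∧ ∀ M N, M < N → r M (Δ M) N (Δ N) := by
  have h' : ∀ M d N, ∃ a, ∀ n ≥ a, 0 < d → r M d N n := fun M d N ↦ by
    obtain rfl | hd := d.eq_zero_or_pos
    · exact ⟨0, by simp⟩
    · obtain ⟨a, ha⟩ := eventually_atTop.1 (h M d N hd)
      exact ⟨a, fun n hn _ ↦ ha n hn⟩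
  choose a ha using h'
  let Δ : ℕ → ℕ := fun N ↦ Nat.strongRec (motive := fun _ ↦ ℕ)
    (fun N ih ↦ 1 + ∑ M : Fin N, a M (ih M M.2) N) N
  have hΔ : ∀ N, Δ N = 1 + ∑ M : Fin N, a M (Δ M) N := fun N ↦ by
    simp only [Δ]
    rw [Nat.strongRec]
  have hpos : ∀ N, 0 < Δ N := fun N ↦ by rw [hΔ]; omega
  refine ⟨Δ, hpos, fun M N hMN ↦ ha M _ N _ ?_ (hpos M)⟩
  have := Finset.single_le_sum (f := fun M : Fin N ↦ a M (Δ M) N) (fun _ _ ↦ Nat.zero_le _)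
    (Finset.mem_univ ⟨M, hMN⟩)
  rw [hΔ N]
  simp only at this
  omega

/-- For large `n`, the sets `A` and `{x | n • x ∈ B}` are quasi-independent. -/
lemma eventually_volume_inter_preimage_nsmul_le {A B : Set 𝕋} (hA : MeasurableSet A)
    (hB : MeasurableSet B) :
    ∀ᶠ n : ℕ in atTop, volume (A ∩ {x : 𝕋 | n • x ∈ B}) ≤
      2 * (volume A * volume {x : 𝕋 | n • x ∈ B}) := by
  have hvol : (volume : Measure 𝕋) = AddCircle.haarAddCircle := by
    simpa using AddCircle.volume_eq_smul_haarAddCircle (T := 1)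
  rw [hvol]
  set μ := AddCircle.haarAddCircle (T := 1)
  have hpre : ∀ n : ℕ, 0 < n → μ {x : 𝕋 | n • x ∈ B} = μ B := fun n hn ↦
    (measurePreserving_nsmul_haarAddCircle hn).measure_preimage hB.nullMeasurableSet
  obtain hA0 | hA0 := eq_or_ne (μ A) 0
  · exact Eventually.of_forall fun n ↦ by simp [measure_mono_null inter_subset_left hA0]
  obtain hB0 | hB0 := eq_or_ne (μ B) 0
  · filter_upwards [eventually_gt_atTop 0] with n hn
    simp [measure_mono_null inter_subset_right ((hpre n hn).trans hB0)]
  have hAB : 0 < μ.real A * μ.real B :=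
    mul_pos (ENNReal.toReal_pos hA0 (measure_ne_top _ _))
      (ENNReal.toReal_pos hB0 (measure_ne_top _ _))
  filter_upwards [eventually_gt_atTop 0, (tendsto_measureReal_inter_preimage_nsmul hA hB).eventually
    (gt_mem_nhds (lt_mul_of_one_lt_left hAB one_lt_two))] with n hn hlt
  rw [hpre n hn, ← ENNReal.toReal_le_toReal (measure_ne_top _ _) (by finiteness)]
  simpa [Measure.real] using hlt.le

/-- **Lemma (quasi-independence via mixing).** For any sequence `(Q_N)` of measurable subsets of
`𝕋` there are positive integers `(Δ_N)` such that the sets `R_N = {α ∈ 𝕋 : Δ_N·α ∈ Q_N}`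
satisfy `Leb(R_M ∩ R_N) ≤ 2·Leb(R_M)·Leb(R_N)` for all `M ≠ N` (pairwise
quasi-independence). -/
theorem stmt_10 (Q : ℕ → Set 𝕋) (hQ : ∀ N, MeasurableSet (Q N)) :
    ∃ Δ : ℕ → ℕ, (∀ N, 0 < Δ N) ∧ ∀ M N : ℕ, M ≠ N →
      volume ({α : 𝕋 | Δ M • α ∈ Q M} ∩ {α : 𝕋 | Δ N • α ∈ Q N}) ≤
        2 * (volume {α : 𝕋 | Δ M • α ∈ Q M} * volume {α : 𝕋 | Δ N • α ∈ Q N}) := by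
  have hmeas : ∀ N d : ℕ, MeasurableSet {α : 𝕋 | d • α ∈ Q N} := fun N d ↦
    (continuous_nsmul d).measurable (hQ N)
  obtain ⟨Δ, hpos, hΔ⟩ := exists_pos_seq_forall_lt fun M d N _ ↦
    eventually_volume_inter_preimage_nsmul_le (hmeas M d) (hQ N)
  refine ⟨Δ, hpos, fun M N hMN ↦ ?_⟩
  obtain h | h := hMN.lt_or_gt
  · exact hΔ M N h
  · rw [inter_comm, mul_comm (volume _)]
    exact hΔ N M h
end
end
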